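/- The braid group B₄ on 4 strings has property RD with respect to the word length associated to the generating set {a, b, c}. -/

import Mathlib

/-- Convolution of finitely supported complex functions on a group:
`(f * g)(x) = ∑_y f(y) g(y⁻¹x)`. -/
noncomputable def conv {Γ : Type*} [Group Γ] (f g : Γ →₀ ℂ) : Γ →₀ ℂ :=
  f.sum fun y cy => g.sum fun z cz => Finsupp.single (y * z) (cy * cz)

/-- The ℓ² norm of a finitely supported complex function. -/
noncomputable def l2norm {Γ : Type*} (f : Γ →₀ ℂ) : ℝ :=
  Real.sqrt (f.sum fun _ c => ‖c‖ ^ 2)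

/-- Property RD of a group with respect to a length function `ℓ`. -/
def HasPropertyRD (Γ : Type*) [Group Γ] (ℓ : Γ → ℝ) : Prop :=
  ∃ P : Polynomial ℝ, ∀ r : ℝ, 0 ≤ r → ∀ f g : Γ →₀ ℂ,
    (∀ x : Γ, f x ≠ 0 → ℓ x ≤ r) →
    l2norm (conv f g) ≤ P.eval r * l2norm f * l2norm g

/-- The word length with respect to a generating set `S` (using `S ∪ S⁻¹`). -/
noncomputable def wordLength {Γ : Type*} [Group Γ] (S : Set Γ) (x : Γ) : ℕ :=
  sInf {n : ℕ | ∃ w : List Γ, w.length = n ∧ (∀ s ∈ w, s ∈ S ∨ s⁻¹ ∈ S) ∧ w.prod = x}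

/-- The braid relations of `B₄ = ⟨a,b,c ∣ aba=bab, bcb=cbc, ac=ca⟩`. -/
def braidRels4 : Set (FreeGroup (Fin 3)) :=
  { FreeGroup.of 0 * FreeGroup.of 1 * FreeGroup.of 0 *
      (FreeGroup.of 1 * FreeGroup.of 0 * FreeGroup.of 1)⁻¹,
    FreeGroup.of 1 * FreeGroup.of 2 * FreeGroup.of 1 *
      (FreeGroup.of 2 * FreeGroup.of 1 * FreeGroup.of 2)⁻¹,
    FreeGroup.of 0 * FreeGroup.of 2 * (FreeGroup.of 2 * FreeGroup.of 0)⁻¹ }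

/-- The braid group on 4 strings. -/
abbrev B4 : Type := PresentedGroup braidRels4

def a : B4 := PresentedGroup.of 0
def b : B4 := PresentedGroup.of 1
def c : B4 := PresentedGroup.of 2

namespace BraidFour

/-! ### The fourteen simple elements of the dual braid monoid -/

/-- Simple elements are coded by `0 = 1`, `1, …, 6` (atoms), `7, …, 12` (rank two), `13 = δ`. -/
abbrev Simple := Fin 14

/-- First factor of the left-weighted rewriting of a product of two simple elements. -/
def leadTable : List (List Simple) :=
  [[0, 1, 2, 3, 4, 5, 6, 7, 8, 9, 10, 11, 12, 13],
   [1, 1, 7, 9, 1, 10, 1, 7, 13, 9, 10, 9, 7, 13],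
   [2, 2, 2, 8, 7, 2, 12, 7, 8, 8, 12, 13, 12, 13],
   [3, 9, 3, 3, 3, 8, 11, 9, 8, 9, 13, 11, 11, 13],
   [4, 7, 4, 11, 4, 4, 4, 7, 11, 13, 7, 11, 4, 13],
   [5, 5, 8, 5, 5, 5, 10, 8, 8, 5, 10, 10, 13, 13],
   [6, 10, 12, 6, 11, 6, 6, 13, 12, 10, 10, 11, 12, 13],
   [7, 7, 7, 13, 7, 7, 7, 7, 13, 13, 7, 13, 7, 13],
   [8, 8, 8, 8, 8, 8, 13, 8, 8, 8, 13, 13, 13, 13],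
   [9, 9, 9, 9, 9, 13, 9, 9, 13, 9, 13, 9, 9, 13],
   [10, 10, 13, 10, 10, 10, 10, 13, 13, 10, 10, 10, 13, 13],
   [11, 13, 11, 11, 11, 11, 11, 13, 11, 13, 13, 11, 11, 13],
   [12, 12, 12, 12, 13, 12, 12, 13, 12, 12, 12, 13, 12, 13],
   [13, 13, 13, 13, 13, 13, 13, 13, 13, 13, 13, 13, 13, 13]]

/-- Second factor of the left-weighted rewriting of a product of two simple elements. -/
def restTable : List (List Simple) :=
  [[0, 0, 0, 0, 0, 0, 0, 0, 0, 0, 0, 0, 0, 0],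
   [0, 1, 0, 0, 4, 0, 6, 4, 0, 1, 6, 6, 6, 6],
   [0, 1, 2, 0, 0, 5, 0, 1, 5, 1, 1, 0, 2, 1],
   [0, 0, 2, 3, 4, 0, 0, 2, 2, 3, 0, 4, 2, 2],
   [0, 0, 2, 0, 4, 5, 6, 2, 5, 0, 5, 6, 12, 5],
   [0, 1, 0, 3, 4, 5, 0, 4, 3, 9, 1, 4, 0, 4],
   [0, 0, 0, 3, 0, 5, 6, 0, 3, 3, 5, 3, 6, 3],
   [0, 1, 2, 0, 4, 5, 6, 7, 5, 1, 10, 6, 12, 10],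
   [0, 1, 2, 3, 4, 5, 0, 7, 8, 9, 1, 4, 2, 7],
   [0, 1, 2, 3, 4, 0, 6, 7, 2, 9, 6, 11, 12, 12],
   [0, 1, 0, 3, 4, 5, 6, 4, 3, 9, 10, 11, 6, 11],
   [0, 0, 2, 3, 4, 5, 6, 2, 8, 3, 5, 11, 12, 8],
   [0, 1, 2, 3, 0, 5, 6, 1, 8, 9, 10, 3, 12, 9],
   [0, 1, 2, 3, 4, 5, 6, 7, 8, 9, 10, 11, 12, 13]]

def lead (s t : Simple) : Simple := (leadTable.getD s []).getD t 0

def rest (s t : Simple) : Simple := (restTable.getD s []).getD t 0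

/-- Conjugation by `δ` on simple elements. -/
def twist (s : Simple) : Simple := rest s 13

/-- The element of the braid group coded by a simple element. -/
def val : Simple → B4
  | 0 => 1
  | 1 => a
  | 2 => b
  | 3 => c
  | 4 => a * b * a⁻¹
  | 5 => b * c * b⁻¹
  | 6 => a * (b * c * b⁻¹) * a⁻¹
  | 7 => a * b
  | 8 => b * c
  | 9 => a * c
  | 10 => a * (b * c * b⁻¹)
  | 11 => (a * b * a⁻¹) * c
  | 12 => b * (a * (b * c * b⁻¹) * a⁻¹)
  | 13 => a * b * c

/-- The dual Garside element. -/
def δ : B4 := a * b * c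

theorem val_top : val 13 = δ := rfl

theorem rel_ab : a * b * a = b * a * b := by
  have h := PresentedGroup.one_of_mem (rels := braidRels4) (x := FreeGroup.of 0 * FreeGroup.of 1 * FreeGroup.of 0 *
      (FreeGroup.of 1 * FreeGroup.of 0 * FreeGroup.of 1)⁻¹) (by simp [braidRels4])
  simp only [map_mul, map_inv] at h
  exact mul_inv_eq_one.mp h

theorem rel_bc : b * c * b = c * b * c := by
  have h := PresentedGroup.one_of_mem (rels := braidRels4) (x := FreeGroup.of 1 * FreeGroup.of 2 * FreeGroup.of 1 *
      (FreeGroup.of 2 * FreeGroup.of 1 * FreeGroup.of 2)⁻¹) (by simp [braidRels4])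
  simp only [map_mul, map_inv] at h
  exact mul_inv_eq_one.mp h

theorem rel_ac : a * c = c * a := by
  have h := PresentedGroup.one_of_mem (rels := braidRels4) (x := FreeGroup.of 0 * FreeGroup.of 2 *
      (FreeGroup.of 2 * FreeGroup.of 0)⁻¹) (by simp [braidRels4])
  simp only [map_mul, map_inv] at h
  exact mul_inv_eq_one.mp h

theorem lead_rest_fact : ∀ s t : Simple, ∃ m, rest s m = 0 ∧ lead s m = lead s t ∧
    rest m (rest s t) = 0 ∧ lead m (rest s t) = t := by decide +kernel

theorem lead_rest_idem : ∀ s t : Simple, lead (lead s t) (rest s t) = lead s t ∧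
    rest (lead s t) (rest s t) = rest s t := by decide +kernel

theorem lead_rest_chain : ∀ t s s' : Simple, lead s s' = s → rest s s' = s' →
    lead (lead t s) (lead (rest t s) s') = lead t s ∧
    rest (lead t s) (lead (rest t s) s') = lead (rest t s) s' := by decide +kernel

theorem lead_rest_mul : ∀ s t u : Simple, rest s t = 0 →
    lead s (lead t u) = lead (lead s t) u ∧
    rest (rest s (lead t u)) (rest t u) = 0 ∧
    lead (rest s (lead t u)) (rest t u) = rest (lead s t) u := by decide +kernel

theorem val_mul (s t : Simple) (h : rest s t = 0) : val s * val t = val (lead s t) := by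
  have hbx : b * (a * b * a⁻¹) = a * b := by
    rw [← mul_assoc, mul_inv_eq_iff_eq_mul, ← mul_assoc]; exact rel_ab.symm
  have hca : c * a = a * c := rel_ac.symm
  have hcy : c * (b * c * b⁻¹) = b * c := by
    rw [← mul_assoc, mul_inv_eq_iff_eq_mul, ← mul_assoc]; exact rel_bc.symm
  have hyb : b * c * b⁻¹ * b = b * c := by group
  have hcai : c * a⁻¹ = a⁻¹ * c := by
    rw [mul_inv_eq_iff_eq_mul, mul_assoc, hca]; group
  set x : B4 := a * b * a⁻¹ with hx
  set y : B4 := b * c * b⁻¹ with hy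
  have hxa : x * a = a * b := by rw [hx]; group
  have hyc : y = c⁻¹ * b * c := by
    rw [mul_assoc, eq_inv_mul_iff_mul_eq]; exact hcy
  have hza : a * y * a⁻¹ * a = a * y := by group
  have hcz : c * (a * y * a⁻¹) = x * c := by
    calc c * (a * y * a⁻¹) = (c * a) * y * a⁻¹ := by group
      _ = a * (c * y) * a⁻¹ := by rw [hca]; group
      _ = a * b * (c * a⁻¹) := by rw [hcy]; group
      _ = x * c := by rw [hcai, hx]; group
  have hzx : a * y * a⁻¹ * x = x * c := by
    calc a * y * a⁻¹ * x = a * (y * b) * a⁻¹ := by rw [hx]; group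
      _ = a * b * (c * a⁻¹) := by rw [hyb]; group
      _ = x * c := by rw [hcai, hx]; group
  have hzb : a * y * a⁻¹ * b = b * (a * y * a⁻¹) := by
    have h1 : b⁻¹ * a⁻¹ * b = a * b⁻¹ * a⁻¹ := by
      rw [mul_assoc, inv_mul_eq_iff_eq_mul, inv_mul_eq_iff_eq_mul]
      calc b = (b * a * b) * b⁻¹ * a⁻¹ := by group
        _ = _ := by rw [← rel_ab]; group
    calc a * y * a⁻¹ * b = a * b * c * (b⁻¹ * a⁻¹ * b) := by rw [hy]; group
      _ = a * b * (c * a) * b⁻¹ * a⁻¹ := by rw [h1]; group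
      _ = (a * b * a) * c * b⁻¹ * a⁻¹ := by rw [hca]; group
      _ = _ := by rw [rel_ab, hy]; group
  have hyz : y * (a * y * a⁻¹) = a * y := by
    rw [← mul_assoc, mul_inv_eq_iff_eq_mul]
    have hcia : c⁻¹ * a = a * c⁻¹ := by rw [inv_mul_eq_iff_eq_mul, ← mul_assoc, hca]; group
    calc y * (a * y) = c⁻¹ * b * (c * a) * c⁻¹ * b * c := by rw [hyc]; group
      _ = c⁻¹ * (b * a * b) * c := by rw [hca]; group
      _ = (c⁻¹ * a) * b * (a * c) := by rw [← rel_ab]; group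
      _ = a * c⁻¹ * b * (c * a) := by rw [hcia, hca]
      _ = a * y * a := by rw [hyc]; group
  have d1 : b * (x * c) = a * b * c := by rw [← mul_assoc, hbx]
  have d2 : c * (a * y) = a * b * c := by rw [← mul_assoc, hca, mul_assoc, hcy, mul_assoc]
  have d3 : x * (a * c) = a * b * c := by rw [← mul_assoc, hxa]
  have d4 : y * (b * (a * y * a⁻¹)) = a * b * c := by rw [← mul_assoc, hyb, mul_assoc, hcz, d1]
  have d5 : a * y * a⁻¹ * (a * b) = a * b * c := by rw [← mul_assoc, hza, mul_assoc, hyb, mul_assoc]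
  have d6 : b * c * (a * y * a⁻¹) = a * b * c := by rw [mul_assoc, hcz, d1]
  have d7 : a * c * y = a * b * c := by rw [mul_assoc, hcy, mul_assoc]
  have d8 : a * y * b = a * b * c := by rw [mul_assoc, hyb, mul_assoc]
  have d9 : x * c * a = a * b * c := by rw [mul_assoc, hca, d3]
  have d10 : b * (a * y * a⁻¹) * x = a * b * c := by rw [mul_assoc, hzx, d1]
  revert h
  fin_cases s <;> fin_cases t <;>
    first
    | (intro h; exact absurd h (by decide))
    | (intro _; exact one_mul _)
    | (intro _; exact mul_one _)
    | (intro _; rfl)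
    | (intro _; exact hbx)
    | (intro _; exact hca)
    | (intro _; exact hcy)
    | (intro _; exact hyb)
    | (intro _; exact hxa)
    | (intro _; exact hza)
    | (intro _; exact hcz)
    | (intro _; exact hzx)
    | (intro _; exact hzb)
    | (intro _; exact hyz)
    | (intro _; exact d1)
    | (intro _; exact d2)
    | (intro _; exact d3)
    | (intro _; exact d4)
    | (intro _; exact d5)
    | (intro _; exact d6)
    | (intro _; exact d7)
    | (intro _; exact d8)
    | (intro _; exact d9)
    | (intro _; exact d10)

theorem val_lead_mul_val_rest (s t : Simple) : val (lead s t) * val (rest s t) = val s * val t := by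
  obtain ⟨m, h1, h2, h3, h4⟩ := lead_rest_fact s t
  rw [← h2, ← val_mul s m h1, mul_assoc, val_mul _ _ h3, h4]

/-! ### Left-weighted words and the action of the braid group on them -/

/-- Left multiplication of a left-weighted word by a simple element. -/
def push : Simple → List Simple → List Simple
  | t, [] => if t = 0 then [] else [t]
  | t, s :: L => lead t s :: push (rest t s) L

/-- Left-weighted words without trivial letters. -/
def IsNormal (L : List Simple) : Prop :=
  L.IsChain (fun s t => lead s t = s ∧ rest s t = t) ∧ ∀ s ∈ L, s ≠ 0

def wordVal (L : List Simple) : B4 := (L.map val).prod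

@[simp] theorem wordVal_nil : wordVal [] = 1 := rfl

@[simp] theorem wordVal_cons (s : Simple) (L : List Simple) :
    wordVal (s :: L) = val s * wordVal L := by simp [wordVal]

theorem wordVal_append (L M : List Simple) : wordVal (L ++ M) = wordVal L * wordVal M := by
  simp [wordVal]

theorem rest_zero_left : ∀ s, rest 0 s = 0 := by decide
theorem lead_zero_right : ∀ s, lead s 0 = s := by decide
theorem lead_top_right : ∀ s, lead s 13 = 13 := by decide
theorem lead_top_left : ∀ s, lead 13 s = 13 := by decide
theorem rest_top_left : ∀ s, rest 13 s = s := by decide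
theorem lead_ne_zero : ∀ s t : Simple, t ≠ 0 → lead s t ≠ 0 := by decide

theorem wordVal_push (t : Simple) (L : List Simple) : wordVal (push t L) = val t * wordVal L := by
  induction L generalizing t with
  | nil =>
    by_cases h : t = 0
    · subst h; simp [push, val]
    · simp [push, h]
  | cons s L ih =>
    rw [push, wordVal_cons, ih, ← mul_assoc, val_lead_mul_val_rest, wordVal_cons, mul_assoc]

theorem push_push (s t : Simple) (h : rest s t = 0) (L : List Simple) :
    push s (push t L) = push (lead s t) L := by
  induction L generalizing s t with
  | nil =>
    by_cases ht : t = 0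
    · subst ht; simp [push, lead_zero_right]
    · simp [push, ht, h, lead_ne_zero s t ht]
  | cons u L ih =>
    obtain ⟨h1, h2, h3⟩ := lead_rest_mul s t u h
    simp only [push]
    rw [ih _ _ h2, h1, h3]

theorem push_of_isNormal_cons (t : Simple) (L : List Simple) (h : IsNormal (t :: L)) :
    push t L = t :: L := by
  induction L generalizing t with
  | nil => simp [push, h.2 t (by simp)]
  | cons s L ih =>
    obtain ⟨h1, h2⟩ := h
    rw [List.isChain_cons_cons] at h1
    rw [push, h1.1.1, h1.1.2, ih s ⟨h1.2, fun x hx => h2 x (List.mem_cons_of_mem _ hx)⟩]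

theorem IsNormal.tail {s : Simple} {L : List Simple} (h : IsNormal (s :: L)) : IsNormal L :=
  ⟨h.1.tail, fun x hx => h.2 x (List.mem_cons_of_mem _ hx)⟩

theorem IsNormal.push {L : List Simple} (h : IsNormal L) (t : Simple) : IsNormal (push t L) := by
  induction L generalizing t with
  | nil =>
    by_cases ht : t = 0
    · simp [BraidFour.push, ht, IsNormal]
    · simp [BraidFour.push, ht, IsNormal]
  | cons s L ih =>
    have hs : s ≠ 0 := h.2 s (by simp)
    have ih' := ih h.tail (rest t s)
    refine ⟨?_, ?_⟩
    · cases L with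
      | nil =>
        by_cases hr : rest t s = 0
        · simp [BraidFour.push, hr]
        · simp [BraidFour.push, hr, lead_rest_idem t s]
      | cons s' L =>
        have h1 := h.1
        rw [List.isChain_cons_cons] at h1
        have := ih'.1
        simp only [BraidFour.push] at this ⊢
        rw [List.isChain_cons_cons]
        exact ⟨lead_rest_chain t s s' h1.1.1 h1.1.2, this⟩
    · intro x hx
      rw [BraidFour.push, List.mem_cons] at hx
      rcases hx with rfl | hx
      · exact lead_ne_zero t s hs
      · exact ih'.2 x hx

theorem isNormal_nil : IsNormal [] := by simp [IsNormal]

theorem isNormal_top_cons {L : List Simple} (h : IsNormal L) : IsNormal (13 :: L) := by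
  refine ⟨?_, fun x hx => ?_⟩
  · cases L with
    | nil => simp
    | cons s L =>
      rw [List.isChain_cons_cons]
      exact ⟨⟨lead_top_left s, rest_top_left s⟩, h.1⟩
  · rcases List.mem_cons.mp hx with rfl | hx
    · decide
    · exact h.2 x hx

/-- Conjugation by `δ` as a permutation of the simple elements. -/
def twistPerm : Equiv.Perm Simple where
  toFun := twist
  invFun s := twist (twist (twist s))
  left_inv := by unfold Function.LeftInverse; decide
  right_inv := by unfold Function.RightInverse Function.LeftInverse; decide

theorem lead_twistPerm_zpow (k : ℤ) : ∀ s t : Simple,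
    lead ((twistPerm ^ k) s) ((twistPerm ^ k) t) = (twistPerm ^ k) (lead s t) ∧
    rest ((twistPerm ^ k) s) ((twistPerm ^ k) t) = (twistPerm ^ k) (rest s t) := by
  induction k with
  | zero => simp
  | succ k ih =>
    intro s t
    have h : ∀ s t, lead (twistPerm s) (twistPerm t) = twistPerm (lead s t) ∧
      rest (twistPerm s) (twistPerm t) = twistPerm (rest s t) := by decide +kernel
    simp only [zpow_add_one, Equiv.Perm.mul_apply]
    rw [(ih _ _).1, (ih _ _).2, (h _ _).1, (h _ _).2]
    exact ⟨rfl, rfl⟩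
  | pred k ih =>
    intro s t
    have h : ∀ s t, lead (twistPerm⁻¹ s) (twistPerm⁻¹ t) = twistPerm⁻¹ (lead s t) ∧
      rest (twistPerm⁻¹ s) (twistPerm⁻¹ t) = twistPerm⁻¹ (rest s t) := by decide +kernel
    simp only [zpow_sub_one, Equiv.Perm.mul_apply]
    rw [(ih _ _).1, (ih _ _).2, (h _ _).1, (h _ _).2]
    exact ⟨rfl, rfl⟩

/-- Signed left-weighted words: `(k, L)` stands for `δ ^ k` times the value of `L`. -/
abbrev SignedWord := ℤ × {L : List Simple // IsNormal L}

/-- Absorbing a leading letter `δ` into the exponent. -/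
def Absorb (x y : SignedWord) : Prop := y.1 = x.1 + 1 ∧ x.2.1 = 13 :: y.2.1

abbrev NormalForm := Quot Absorb

def act (t : Simple) : NormalForm → NormalForm :=
  Quot.map (fun x => (x.1, ⟨push ((twistPerm ^ x.1) t) x.2.1, x.2.2.push _⟩)) (by
    rintro ⟨k, L, hL⟩ ⟨k', L', hL'⟩ ⟨h1, h2⟩
    dsimp only at h1 h2
    subst h1 h2
    refine ⟨rfl, ?_⟩
    dsimp only
    rw [push, lead_top_right, add_comm k 1, zpow_add, zpow_one, Equiv.Perm.mul_apply]
    rfl)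

theorem twistPerm_zpow_zero (k : ℤ) : (twistPerm ^ k) 0 = 0 := by
  have h := (lead_twistPerm_zpow k 0 ((twistPerm ^ k).symm 0)).2
  rw [rest_zero_left, Equiv.apply_symm_apply] at h
  exact h.symm.trans ((by decide : ∀ s, rest s 0 = 0) _)

theorem twistPerm_zpow_top (k : ℤ) : (twistPerm ^ k) 13 = 13 := by
  have h := (lead_twistPerm_zpow k ((twistPerm ^ k).symm 13) 13).1
  rw [lead_top_right, Equiv.apply_symm_apply, lead_top_left] at h
  exact h.symm

theorem act_act (s t : Simple) (h : rest s t = 0) (x : NormalForm) :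
    act s (act t x) = act (lead s t) x := by
  induction x using Quot.ind with
  | mk x =>
    simp only [act, Quot.map]
    congr 3
    rw [push_push _ _ (by rw [(lead_twistPerm_zpow _ _ _).2, h, twistPerm_zpow_zero]),
      (lead_twistPerm_zpow _ _ _).1]

theorem act_top (x : SignedWord) : act 13 (Quot.mk _ x) = Quot.mk _ (x.1 + 1, x.2) := by
  refine Quot.sound ⟨rfl, ?_⟩
  dsimp only
  rw [twistPerm_zpow_top, push_of_isNormal_cons _ _ (isNormal_top_cons x.2.2)]

theorem act_top_bijective : Function.Bijective (act 13) := by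
  let inv : NormalForm → NormalForm :=
    Quot.map (fun x => (x.1 - 1, x.2)) (by
      rintro x y ⟨h1, h2⟩
      exact ⟨by dsimp only; omega, h2⟩)
  refine Function.bijective_iff_has_inverse.mpr ⟨inv, fun x => ?_, fun x => ?_⟩
  · induction x using Quot.ind with
    | mk x => rw [act_top]; simp [inv, Quot.map]
  · induction x using Quot.ind with
    | mk x => simp only [inv, Quot.map]; rw [act_top]; simp

theorem act_bijective (s : Simple) : Function.Bijective (act s) := by
  obtain ⟨t, h1, h2⟩ := (by decide : ∀ s, ∃ t, rest s t = 0 ∧ lead s t = 13) s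
  obtain ⟨u, h3, h4⟩ := (by decide : ∀ s, ∃ t, rest t s = 0 ∧ lead t s = 13) s
  have e1 : act s ∘ act t = act 13 := by funext x; rw [← h2]; exact act_act s t h1 x
  have e2 : act u ∘ act s = act 13 := by funext x; rw [← h4]; exact act_act u s h3 x
  constructor
  · exact Function.Injective.of_comp (f := act u) (e2 ▸ act_top_bijective.1)
  · exact Function.Surjective.of_comp (g := act t) (e1 ▸ act_top_bijective.2)

noncomputable def actPerm (s : Simple) : Equiv.Perm NormalForm :=
  Equiv.ofBijective (act s) (act_bijective s)

theorem actPerm_mul (s t : Simple) (h : rest s t = 0) :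
    actPerm s * actPerm t = actPerm (lead s t) := by
  ext x; exact act_act s t h x

/-- The action of the braid group on normal forms. -/
noncomputable def actHom : B4 →* Equiv.Perm NormalForm :=
  PresentedGroup.toGroup (f := ![actPerm 1, actPerm 2, actPerm 3]) (by
    have hab : actPerm 1 * actPerm 2 = actPerm 7 := actPerm_mul 1 2 (by decide)
    have hxa : actPerm 4 * actPerm 1 = actPerm 7 := actPerm_mul 4 1 (by decide)
    have hbx : actPerm 2 * actPerm 4 = actPerm 7 := actPerm_mul 2 4 (by decide)
    have hbc : actPerm 2 * actPerm 3 = actPerm 8 := actPerm_mul 2 3 (by decide)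
    have hyb : actPerm 5 * actPerm 2 = actPerm 8 := actPerm_mul 5 2 (by decide)
    have hcy : actPerm 3 * actPerm 5 = actPerm 8 := actPerm_mul 3 5 (by decide)
    have hac : actPerm 1 * actPerm 3 = actPerm 9 := actPerm_mul 1 3 (by decide)
    have hca : actPerm 3 * actPerm 1 = actPerm 9 := actPerm_mul 3 1 (by decide)
    intro r hr
    simp only [braidRels4, Set.mem_insert_iff, Set.mem_singleton_iff] at hr
    rcases hr with rfl | rfl | rfl
    · simp only [map_mul, map_inv, FreeGroup.lift_apply_of, Matrix.cons_val_zero,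
        Matrix.cons_val_one, mul_inv_eq_one]
      rw [mul_assoc (actPerm 2), hab]
      nth_rw 2 [← hxa]
      rw [← mul_assoc, hbx]
    · simp only [map_mul, map_inv, FreeGroup.lift_apply_of, Matrix.cons_val,
        mul_inv_eq_one]
      rw [mul_assoc (actPerm 3), hbc]
      nth_rw 2 [← hyb]
      rw [← mul_assoc, hcy]
    · simp only [map_mul, map_inv, FreeGroup.lift_apply_of, Matrix.cons_val_zero,
        Matrix.cons_val, mul_inv_eq_one]
      rw [hac, hca])

theorem actHom_val : ∀ s, actHom (val s) = actPerm s := by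
  have mulr : ∀ s t, rest s t = 0 → actHom (val s) = actPerm s → actHom (val t) = actPerm t →
      actHom (val (lead s t)) = actPerm (lead s t) := by
    intro s t h hs ht
    rw [← val_mul s t h, map_mul, hs, ht, actPerm_mul s t h]
  have divr : ∀ s t, rest s t = 0 → actHom (val (lead s t)) = actPerm (lead s t) →
      actHom (val t) = actPerm t → actHom (val s) = actPerm s := by
    intro s t h hs ht
    rw [← val_mul s t h, map_mul, ht, ← actPerm_mul s t h] at hs
    exact mul_right_cancel hs
  have h1 : actHom (val 1) = actPerm 1 := PresentedGroup.toGroup.of ..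
  have h2 : actHom (val 2) = actPerm 2 := PresentedGroup.toGroup.of ..
  have h3 : actHom (val 3) = actPerm 3 := PresentedGroup.toGroup.of ..
  have h7 := mulr 1 2 (by decide) h1 h2
  have h8 := mulr 2 3 (by decide) h2 h3
  have h9 := mulr 1 3 (by decide) h1 h3
  have h4 := divr 4 1 (by decide) h7 h1
  have h5 := divr 5 2 (by decide) h8 h2
  have h10 := mulr 1 5 (by decide) h1 h5
  have h6 := divr 6 1 (by decide) h10 h1
  have h11 := mulr 4 3 (by decide) h4 h3
  have h12 := mulr 2 6 (by decide) h2 h6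
  have h13 := mulr 7 3 (by decide) h7 h3
  have h0 := divr 0 1 (by decide) h1 h1
  intro s
  fin_cases s <;> assumption

theorem actHom_wordVal (L : List Simple) (h : IsNormal L) :
    actHom (wordVal L) (Quot.mk _ (0, ⟨[], isNormal_nil⟩)) = Quot.mk _ (0, ⟨L, h⟩) := by
  induction L with
  | nil => simp
  | cons s L ih =>
    rw [wordVal_cons, map_mul, Equiv.Perm.mul_apply, ih h.tail, actHom_val]
    simp only [actPerm, Equiv.ofBijective_apply, act, Quot.map, zpow_zero, Equiv.Perm.one_apply]
    congr 3
    exact push_of_isNormal_cons s L h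

/-- Move the leading letters `δ` of a word into the exponent. -/
def absorbTop : ℤ → List Simple → ℤ × List Simple
  | k, [] => (k, [])
  | k, s :: L => if s = 13 then absorbTop (k + 1) L else (k, s :: L)

theorem le_absorbTop (k : ℤ) (L : List Simple) : k ≤ (absorbTop k L).1 := by
  induction L generalizing k with
  | nil => exact le_rfl
  | cons s L ih =>
    rw [absorbTop]
    split_ifs
    · exact (by omega : k ≤ k + 1).trans (ih _)
    · exact le_rfl

theorem absorbTop_injective (k : ℤ) (L M : List Simple) (h : absorbTop k L = absorbTop k M) :
    L = M := by
  induction L generalizing k M with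
  | nil =>
    cases M with
    | nil => rfl
    | cons s M =>
      by_cases hs : s = 13
      · simp only [absorbTop, hs, if_true] at h
        have := le_absorbTop (k + 1) M
        rw [← h] at this; dsimp only at this; omega
      · simp [absorbTop, hs] at h
  | cons t L ih =>
    by_cases ht : t = 13
    · cases M with
      | nil =>
        simp only [absorbTop, ht, if_true] at h
        have := le_absorbTop (k + 1) L
        rw [h] at this; dsimp only at this; omega
      | cons s M =>
        by_cases hs : s = 13
        · simp only [absorbTop, hs, ht, if_true] at h
          rw [hs, ht, ih _ _ h]
        · simp only [absorbTop, hs, ht, if_true, if_false] at h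
          have := le_absorbTop (k + 1) L
          rw [h] at this; dsimp only at this; omega
    · cases M with
      | nil => simp [absorbTop, ht] at h
      | cons s M =>
        by_cases hs : s = 13
        · simp only [absorbTop, hs, ht, if_true, if_false] at h
          have := le_absorbTop (k + 1) M
          rw [← h] at this; dsimp only at this; omega
        · simp only [absorbTop, hs, ht, if_false] at h
          exact (Prod.ext_iff.mp h).2

theorem wordVal_injective {L M : List Simple} (hL : IsNormal L) (hM : IsNormal M)
    (h : wordVal L = wordVal M) : L = M := by
  let f : NormalForm → ℤ × List Simple :=
    Quot.lift (fun x => absorbTop x.1 x.2.1) (by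
      rintro x y ⟨h1, h2⟩
      rw [h2, h1, absorbTop, if_pos rfl])
  have h1 := actHom_wordVal L hL
  rw [h, actHom_wordVal M hM] at h1
  exact (absorbTop_injective 0 M L (congrArg f h1)).symm

/-- Every product of simple elements has a left-weighted expression that is not longer. -/
theorem exists_isNormal (L : List Simple) :
    ∃ M, IsNormal M ∧ wordVal M = wordVal L ∧ M.length ≤ L.length := by
  induction L with
  | nil => exact ⟨[], isNormal_nil, rfl, le_rfl⟩
  | cons s L ih =>
    obtain ⟨M, h1, h2, h3⟩ := ih
    refine ⟨push s M, h1.push s, by rw [wordVal_push, h2, wordVal_cons], ?_⟩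
    have : ∀ (M : List Simple) s, (push s M).length ≤ M.length + 1 := by
      intro M
      induction M with
      | nil => intro s; simp only [push]; split_ifs <;> simp
      | cons t M ih => intro s; simpa [push] using ih _
    exact (this M s).trans (by simpa using h3)

/-! ### The dual Garside order -/

theorem val_mul_delta (s : Simple) : val s * δ = δ * val (twist s) := by
  have h := val_lead_mul_val_rest s 13
  rw [lead_top_right] at h
  exact h.symm

theorem wordVal_mul_delta (L : List Simple) : wordVal L * δ = δ * wordVal (L.map twist) := by
  induction L with
  | nil => simp
  | cons s L ih =>
    rw [wordVal_cons, mul_assoc, ih, ← mul_assoc, val_mul_delta, List.map_cons, wordVal_cons,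
      mul_assoc]

theorem val_eq_one {s : Simple} (h : s = 0) : val s = 1 := by subst h; rfl

def rank : Simple → ℤ := fun s =>
  if s = 0 then 0 else if s ≤ 6 then 1 else if s ≤ 12 then 2 else 3

/-- The degree homomorphism, sending each of the standard generators to `1`. -/
noncomputable def degHom : B4 →* Multiplicative ℤ :=
  PresentedGroup.toGroup (f := fun _ => Multiplicative.ofAdd 1) (by
    intro r hr
    simp only [braidRels4, Set.mem_insert_iff, Set.mem_singleton_iff] at hr
    rcases hr with rfl | rfl | rfl <;> simp)

noncomputable def deg (x : B4) : ℤ := (degHom x).toAdd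

@[simp] theorem deg_one : deg 1 = 0 := by simp [deg]
@[simp] theorem deg_mul (x y : B4) : deg (x * y) = deg x + deg y := by simp [deg]
@[simp] theorem deg_inv (x : B4) : deg x⁻¹ = -deg x := by simp [deg]
@[simp] theorem deg_zpow (x : B4) (k : ℤ) : deg (x ^ k) = k * deg x := by simp [deg]
@[simp] theorem deg_a : deg a = 1 := by
  change Multiplicative.toAdd (PresentedGroup.toGroup _ _) = 1; erw [PresentedGroup.toGroup.of]; rfl
@[simp] theorem deg_b : deg b = 1 := by
  change Multiplicative.toAdd (PresentedGroup.toGroup _ _) = 1; erw [PresentedGroup.toGroup.of]; rfl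
@[simp] theorem deg_c : deg c = 1 := by
  change Multiplicative.toAdd (PresentedGroup.toGroup _ _) = 1; erw [PresentedGroup.toGroup.of]; rfl

@[simp] theorem deg_delta : deg δ = 3 := by simp [δ]

theorem deg_val (s : Simple) : deg (val s) = rank s := by
  fin_cases s <;> simp [val, rank]

theorem rank_pos : ∀ s : Simple, s ≠ 0 → 1 ≤ rank s := by decide

theorem rank_nonneg : ∀ s : Simple, 0 ≤ rank s := by decide

theorem deg_wordVal_nonneg (L : List Simple) : 0 ≤ deg (wordVal L) := by
  induction L with
  | nil => simp
  | cons s L ih => rw [wordVal_cons, deg_mul, deg_val]; linarith [rank_nonneg s]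

theorem wordVal_eq_one_of_deg (L : List Simple) (h : deg (wordVal L) ≤ 0) : wordVal L = 1 := by
  induction L with
  | nil => rfl
  | cons s L ih =>
    rw [wordVal_cons, deg_mul, deg_val] at h
    have h1 := deg_wordVal_nonneg L
    have h2 := rank_nonneg s
    have h3 : s = 0 := by
      by_contra hs
      linarith [rank_pos s hs]
    rw [wordVal_cons, ih (by linarith), val_eq_one h3, one_mul]

/-- The prefix order of the dual braid monoid. -/
instance : PartialOrder B4 where
  le x y := ∃ L, y = x * wordVal L
  le_refl x := ⟨[], by simp⟩
  le_trans := by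
    rintro x y z ⟨L, rfl⟩ ⟨M, rfl⟩
    exact ⟨L ++ M, by rw [wordVal_append, mul_assoc]⟩
  le_antisymm := by
    rintro x y ⟨L, rfl⟩ ⟨M, h⟩
    have h1 := congrArg deg h
    simp only [deg_mul] at h1
    rw [wordVal_eq_one_of_deg L (by linarith [deg_wordVal_nonneg M]), mul_one]

theorem le_iff_exists (x y : B4) : x ≤ y ↔ ∃ L, y = x * wordVal L := Iff.rfl

theorem mul_le_mul_left_iff (z : B4) {x y : B4} : z * x ≤ z * y ↔ x ≤ y := by
  simp only [le_iff_exists, mul_assoc, mul_right_inj]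

theorem deg_mono {x y : B4} (h : x ≤ y) : deg x ≤ deg y := by
  obtain ⟨L, rfl⟩ := h
  rw [deg_mul]; linarith [deg_wordVal_nonneg L]

theorem eq_of_le_of_deg {x y : B4} (h : x ≤ y) (h' : deg y ≤ deg x) : x = y := by
  obtain ⟨L, rfl⟩ := h
  rw [deg_mul] at h'
  rw [wordVal_eq_one_of_deg L (by linarith), mul_one]

theorem deg_lt {x y : B4} (h : x ≤ y) (h' : x ≠ y) : deg x < deg y :=
  lt_of_not_ge fun h'' => h' (eq_of_le_of_deg h h'')

theorem mul_delta_le {x y : B4} (h : x ≤ y) : x * δ ≤ y * δ := by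
  obtain ⟨L, rfl⟩ := h
  exact ⟨L.map twist, by rw [mul_assoc, wordVal_mul_delta, mul_assoc]⟩

theorem mul_delta_inv_le {x y : B4} (h : x ≤ y) : x * δ⁻¹ ≤ y * δ⁻¹ := by
  obtain ⟨L, rfl⟩ := h
  refine ⟨((L.map twist).map twist).map twist, ?_⟩
  have h4 : (((L.map twist).map twist).map twist).map twist = L := by
    simp only [List.map_map]
    conv_rhs => rw [← List.map_id L]
    congr 1
    funext s
    exact (by decide : ∀ s, twist (twist (twist (twist s))) = s) s
  have h := wordVal_mul_delta (((L.map twist).map twist).map twist)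
  rw [h4] at h
  rw [mul_inv_eq_iff_eq_mul, mul_assoc, mul_assoc, h]
  group

theorem mul_delta_zpow_le (k : ℤ) {x y : B4} (h : x ≤ y) : x * δ ^ k ≤ y * δ ^ k := by
  induction k with
  | zero => simpa using h
  | succ k ih => rw [zpow_add_one, ← mul_assoc, ← mul_assoc]; exact mul_delta_le ih
  | pred k ih => rw [zpow_sub_one, ← mul_assoc, ← mul_assoc]; exact mul_delta_inv_le ih

theorem mul_delta_zpow_le_iff (k : ℤ) {x y : B4} : x * δ ^ k ≤ y * δ ^ k ↔ x ≤ y := by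
  refine ⟨fun h => ?_, mul_delta_zpow_le k⟩
  have := mul_delta_zpow_le (-k) h
  simpa [mul_assoc] using this

theorem one_le_wordVal (L : List Simple) : 1 ≤ wordVal L := ⟨L, by simp⟩

theorem val_le_delta (s : Simple) : val s ≤ δ := by
  obtain ⟨t, h1, h2⟩ := (by decide : ∀ s, ∃ t, rest s t = 0 ∧ lead s t = 13) s
  exact ⟨[t], by rw [wordVal_cons, wordVal_nil, mul_one, val_mul s t h1, h2]; rfl⟩

theorem one_le_val (s : Simple) : 1 ≤ val s := ⟨[s], by simp⟩

theorem one_le_delta : 1 ≤ δ := one_le_val 13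

theorem le_mul_delta_pow (x : B4) (n : ℕ) : x ≤ x * δ ^ n := by
  refine ⟨List.replicate n 13, ?_⟩
  simp [wordVal, val_top]

theorem wordVal_le_delta_pow (L : List Simple) : wordVal L ≤ δ ^ L.length := by
  induction L with
  | nil => simp
  | cons s L ih =>
    rw [wordVal_cons, List.length_cons, pow_succ]
    calc val s * wordVal L ≤ val s * δ ^ L.length := (mul_le_mul_left_iff _).mpr ih
      _ ≤ δ * δ ^ L.length := by
        simpa using mul_delta_zpow_le (L.length : ℤ) (val_le_delta s)
      _ = _ := by rw [← pow_succ', pow_succ]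

theorem delta_pow_mono {m n : ℕ} (h : m ≤ n) : (δ : B4) ^ m ≤ δ ^ n := by
  obtain ⟨k, rfl⟩ := Nat.exists_eq_add_of_le h
  rw [pow_add]; exact le_mul_delta_pow _ _

theorem isNormal_map_twist {L : List Simple} (h : IsNormal L) : IsNormal (L.map twist) := by
  refine ⟨?_, ?_⟩
  · rw [List.isChain_map]
    refine h.1.imp fun s t hst => ?_
    exact (by decide +kernel : ∀ s t, lead s t = s ∧ rest s t = t →
      lead (twist s) (twist t) = twist s ∧ rest (twist s) (twist t) = twist t) s t hst
  · intro x hx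
    obtain ⟨s, hs, rfl⟩ := List.mem_map.mp hx
    exact (by decide : ∀ s, s ≠ 0 → twist s ≠ 0) s (h.2 s hs)

theorem length_le_length_push (t : Simple) (L : List Simple) :
    L.length ≤ (push t L).length := by
  induction L generalizing t with
  | nil => simp
  | cons s L ih => simpa [push] using ih _

theorem length_le_of_wordVal_eq_mul {L M : List Simple} (hL : IsNormal L) (hM : IsNormal M)
    (K : List Simple) (h : wordVal M = wordVal K * wordVal L) : L.length ≤ M.length := by
  induction K generalizing M with
  | nil => rw [wordVal_nil, one_mul] at h; rw [wordVal_injective hM hL h]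
  | cons t K ih =>
    obtain ⟨N, h1, h2, -⟩ := exists_isNormal (K ++ L)
    have h3 := ih h1 (by rw [h2, wordVal_append])
    have h4 : M = push t N := by
      refine wordVal_injective hM (h1.push t) ?_
      rw [h, wordVal_push, h2, wordVal_append, wordVal_cons, mul_assoc]
    rw [h4]
    exact h3.trans (length_le_length_push t N)

theorem isNormal_replicate_top (n : ℕ) : IsNormal (List.replicate n 13) := by
  induction n with
  | zero => exact isNormal_nil
  | succ n ih => exact isNormal_top_cons ih

theorem wordVal_replicate_top (n : ℕ) : wordVal (List.replicate n 13) = δ ^ n := by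
  simp [wordVal, val_top]

theorem length_le_of_le_delta_pow {L : List Simple} (hL : IsNormal L) (n : ℕ)
    (h : wordVal L ≤ δ ^ n) : L.length ≤ n := by
  obtain ⟨K, hK⟩ := h
  have key : ∀ j : ℕ, ∃ L', IsNormal L' ∧ L'.length = L.length ∧
      wordVal L * δ ^ j = δ ^ j * wordVal L' := by
    intro j
    induction j with
    | zero => exact ⟨L, hL, rfl, by simp⟩
    | succ j ih =>
      obtain ⟨L', h1, h2, h3⟩ := ih
      refine ⟨L'.map twist, isNormal_map_twist h1, by simpa using h2, ?_⟩
      rw [pow_succ, ← mul_assoc, h3, mul_assoc, wordVal_mul_delta, mul_assoc]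
  obtain ⟨L', h1, h2, h3⟩ := key n
  have h4 : wordVal (List.replicate n 13) = wordVal K * wordVal L' := by
    rw [wordVal_replicate_top]
    rw [hK, mul_assoc] at h3
    have := mul_left_cancel h3
    rw [← this, ← hK]
  have := length_le_of_wordVal_eq_mul h1 (isNormal_replicate_top n) K h4
  simpa [h2] using this

theorem val_mul_wordVal_take_le (t : Simple) (N : List Simple) (i : ℕ) :
    val t * wordVal (N.take i) ≤ wordVal ((push t N).take (i + 1)) := by
  have hnil : ∀ t : Simple, val t ≤ wordVal ((push t []).take 1) := by
    intro t
    by_cases ht : t = 0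
    · subst ht; simp [push, val]
    · simp [push, ht]
  induction N generalizing t i with
  | nil =>
    rw [List.take_nil, wordVal_nil, mul_one]
    refine (hnil t).trans ?_
    rw [List.take_of_length_le (by simp only [push]; split_ifs <;> simp),
      List.take_of_length_le (by simp only [push]; split_ifs <;> simp)]
  | cons s N ih =>
    cases i with
    | zero =>
      obtain ⟨m, h1, h2, -⟩ := lead_rest_fact t s
      simp only [List.take_zero, wordVal_nil, mul_one, push, zero_add, List.take_succ_cons,
        wordVal_cons]
      rw [← h2, ← val_mul t m h1]
      exact ⟨[m], by simp⟩
    | succ i =>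
      simp only [push, List.take_succ_cons, wordVal_cons]
      rw [← mul_assoc, ← val_lead_mul_val_rest, mul_assoc, mul_le_mul_left_iff]
      exact ih (rest t s) i

theorem wordVal_le_take {L : List Simple} (hL : IsNormal L) (H : List Simple) (j : ℕ)
    (hH : H.length ≤ j) (h : wordVal H ≤ wordVal L) : wordVal H ≤ wordVal (L.take j) := by
  induction H generalizing L j with
  | nil => exact one_le_wordVal _
  | cons t H ih =>
    obtain ⟨K, hK⟩ := h
    obtain ⟨N, h1, h2, -⟩ := exists_isNormal (H ++ K)
    have h3 : L = push t N := by
      refine wordVal_injective hL (h1.push t) ?_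
      rw [hK, wordVal_push, h2, wordVal_append, wordVal_cons, mul_assoc]
    obtain ⟨j, rfl⟩ : ∃ i, j = i + 1 := ⟨j - 1, by simp at hH; omega⟩
    have h4 := ih h1 j (by simpa using hH) ⟨K, by rw [h2, wordVal_append]⟩
    rw [h3, wordVal_cons]
    exact ((mul_le_mul_left_iff _).mpr h4).trans (val_mul_wordVal_take_le t N j)

theorem exists_isNormal_of_one_le {x : B4} (h : 1 ≤ x) : ∃ L, IsNormal L ∧ wordVal L = x := by
  obtain ⟨L, hL⟩ := h
  obtain ⟨M, h1, h2, -⟩ := exists_isNormal L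
  exact ⟨M, h1, by rw [h2, hL, one_mul]⟩

theorem le_wordVal_take {L : List Simple} (hL : IsNormal L) {x : B4} (h1 : 1 ≤ x) (n : ℕ)
    (h2 : x ≤ δ ^ n) (h3 : x ≤ wordVal L) : x ≤ wordVal (L.take n) := by
  obtain ⟨H, hH, rfl⟩ := exists_isNormal_of_one_le h1
  exact wordVal_le_take hL H n (length_le_of_le_delta_pow hH n h2) h3

/-- Elements between `1` and `δ` are simple. -/
theorem exists_val_eq {x : B4} (h1 : 1 ≤ x) (h2 : x ≤ δ) : ∃ s, val s = x := by
  obtain ⟨L, hL, rfl⟩ := exists_isNormal_of_one_le h1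
  have h := length_le_of_le_delta_pow hL 1 (by simpa using h2)
  match L, h with
  | [], _ => exact ⟨0, rfl⟩
  | [s], _ => exact ⟨s, by simp⟩

theorem word_between (w : List B4) (hw : ∀ s ∈ w, s ∈ ({a, b, c} : Set B4) ∨ s⁻¹ ∈ ({a, b, c} : Set B4)) :
    (δ : B4) ^ (-(w.length : ℤ)) ≤ w.prod ∧ w.prod ≤ δ ^ w.length := by
  have hgen : ∀ s : B4, s ∈ ({a, b, c} : Set B4) → 1 ≤ s ∧ s ≤ δ := by
    rintro s (rfl | rfl | rfl)
    · exact ⟨one_le_val 1, val_le_delta 1⟩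
    · exact ⟨one_le_val 2, val_le_delta 2⟩
    · exact ⟨one_le_val 3, val_le_delta 3⟩
  have hgen' : ∀ s : B4, s ∈ ({a, b, c} : Set B4) ∨ s⁻¹ ∈ ({a, b, c} : Set B4) →
      δ⁻¹ ≤ s ∧ s ≤ δ := by
    have hd : (δ : B4)⁻¹ ≤ 1 := by simpa using mul_delta_inv_le one_le_delta
    rintro s (h | h)
    · exact ⟨hd.trans (hgen s h).1, (hgen s h).2⟩
    · obtain ⟨h1, h2⟩ := hgen _ h
      refine ⟨?_, ?_⟩
      · have := (mul_le_mul_left_iff s).mpr h2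
        rw [mul_inv_cancel] at this
        simpa using mul_delta_inv_le this
      · have := (mul_le_mul_left_iff s).mpr h1
        rw [mul_inv_cancel, mul_one] at this
        exact this.trans one_le_delta
  induction w with
  | nil => simp
  | cons s w ih =>
    obtain ⟨h1, h2⟩ := ih fun t ht => hw t (List.mem_cons_of_mem _ ht)
    obtain ⟨h3, h4⟩ := hgen' s (hw s (by simp))
    rw [List.prod_cons, List.length_cons]
    constructor
    · calc (δ : B4) ^ (-((w.length + 1 : ℕ) : ℤ)) = δ⁻¹ * δ ^ (-(w.length : ℤ)) := by
            rw [← zpow_neg_one, ← zpow_add]; congr 1; push_cast; ring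
        _ ≤ s * δ ^ (-(w.length : ℤ)) := mul_delta_zpow_le _ h3
        _ ≤ s * w.prod := (mul_le_mul_left_iff _).mpr h1
    · calc s * w.prod ≤ s * δ ^ w.length := (mul_le_mul_left_iff _).mpr h2
        _ ≤ δ * δ ^ w.length := by simpa using mul_delta_zpow_le (w.length : ℤ) h4
        _ = _ := by rw [pow_succ']

theorem exists_word (x : B4) : ∃ w : List B4,
    (∀ s ∈ w, s ∈ ({a, b, c} : Set B4) ∨ s⁻¹ ∈ ({a, b, c} : Set B4)) ∧ w.prod = x := by
  have h : x ∈ Subgroup.closure ({a, b, c} : Set B4) := by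
    have h1 : Set.range (PresentedGroup.of : Fin 3 → B4) ⊆ ({a, b, c} : Set B4) := by
      rintro _ ⟨i, rfl⟩
      fin_cases i
      · exact Or.inl rfl
      · exact Or.inr (Or.inl rfl)
      · exact Or.inr (Or.inr rfl)
    have h2 := Subgroup.closure_mono h1
    rw [PresentedGroup.closure_range_of] at h2
    exact h2 (Subgroup.mem_top x)
  rw [← Subgroup.mem_toSubmonoid, Subgroup.closure_toSubmonoid] at h
  obtain ⟨w, h1, h2⟩ := Submonoid.exists_list_of_mem_closure h
  exact ⟨w, fun s hs => h1 s hs, h2⟩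

theorem exists_between (x : B4) : ∃ n : ℕ, (δ : B4) ^ (-(n : ℤ)) ≤ x ∧ x ≤ δ ^ n := by
  obtain ⟨w, h1, rfl⟩ := exists_word x
  exact ⟨_, word_between w h1⟩

theorem one_le_delta_pow_mul {x : B4} {n : ℕ} (h : (δ : B4) ^ (-(n : ℤ)) ≤ x) : 1 ≤ δ ^ n * x := by
  have := (mul_le_mul_left_iff (δ ^ n)).mpr h
  simpa using this

theorem exists_inf (x y : B4) : ∃ z, z ≤ x ∧ z ≤ y ∧ ∀ w, w ≤ x → w ≤ y → w ≤ z := by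
  obtain ⟨n, hn, -⟩ := exists_between (x⁻¹ * y)
  obtain ⟨L, hL, hv⟩ := exists_isNormal_of_one_le (one_le_delta_pow_mul hn)
  have hy : y = x * (δ ^ n)⁻¹ * wordVal L := by rw [hv]; group
  refine ⟨x * (δ ^ n)⁻¹ * wordVal (L.take n), ?_, ?_, ?_⟩
  · have h1 : wordVal (L.take n) ≤ δ ^ n :=
      (wordVal_le_delta_pow _).trans (delta_pow_mono (List.length_take_le _ _))
    have := (mul_le_mul_left_iff (x * (δ ^ n)⁻¹)).mpr h1
    simpa using this
  · rw [hy, mul_le_mul_left_iff]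
    exact ⟨L.drop n, by rw [← wordVal_append, List.take_append_drop]⟩
  · intro w hwx hwy
    obtain ⟨i, hi, -⟩ := exists_between (δ ^ n * x⁻¹ * w)
    have h1 := one_le_delta_pow_mul hi
    have h2 : δ ^ i * (δ ^ n * x⁻¹ * w) ≤ δ ^ (i + n) := by
      have := (mul_le_mul_left_iff (δ ^ i * (δ ^ n * x⁻¹))).mpr hwx
      rw [pow_add]
      simpa [mul_assoc] using this
    have hrep : IsNormal (List.replicate i 13 ++ L) := by
      clear h1 h2 hi
      induction i with
      | zero => simpa using hL
      | succ i ih => rw [List.replicate_succ, List.cons_append]; exact isNormal_top_cons ih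
    have h3 : δ ^ i * (δ ^ n * x⁻¹ * w) ≤ wordVal (List.replicate i 13 ++ L) := by
      rw [wordVal_append, wordVal_replicate_top, mul_le_mul_left_iff, hv, mul_assoc,
        mul_le_mul_left_iff, mul_le_mul_left_iff]
      exact hwy
    have h4 := le_wordVal_take hrep h1 (i + n) h2 h3
    rw [List.take_append, List.length_replicate, List.take_of_length_le (by simp),
      Nat.add_sub_cancel_left, wordVal_append, wordVal_replicate_top, mul_le_mul_left_iff] at h4
    have := (mul_le_mul_left_iff (x * (δ ^ n)⁻¹)).mpr h4
    simpa [mul_assoc] using this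

noncomputable instance : SemilatticeInf B4 where
  inf x y := (exists_inf x y).choose
  inf_le_left x y := (exists_inf x y).choose_spec.1
  inf_le_right x y := (exists_inf x y).choose_spec.2.1
  le_inf x y z h1 h2 := (exists_inf y z).choose_spec.2.2 x h1 h2

/-! ### Right translation by powers of `δ` -/

/-- Right translation by a power of the Garside element. -/
def sh (k : ℤ) (x : B4) : B4 := x * δ ^ k

@[simp] theorem sh_zero (x : B4) : sh 0 x = x := by simp [sh]

@[simp] theorem sh_sh (j k : ℤ) (x : B4) : sh j (sh k x) = sh (k + j) x := by
  simp [sh, mul_assoc, zpow_add]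

@[simp] theorem sh_le_sh (k : ℤ) {x y : B4} : sh k x ≤ sh k y ↔ x ≤ y := mul_delta_zpow_le_iff k

@[simp] theorem deg_sh (k : ℤ) (x : B4) : deg (sh k x) = deg x + 3 * k := by
  simp [sh, mul_comm]

theorem mul_sh (g : B4) (k : ℤ) (x : B4) : g * sh k x = sh k (g * x) := by simp [sh, mul_assoc]

theorem le_sh_of_nonneg (x : B4) {k : ℤ} (hk : 0 ≤ k) : x ≤ sh k x := by
  obtain ⟨n, rfl⟩ := Int.eq_ofNat_of_zero_le hk
  simpa [sh] using le_mul_delta_pow x n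

theorem sh_mono_left {j k : ℤ} (h : j ≤ k) (x : B4) : sh j x ≤ sh k x := by
  have := le_sh_of_nonneg (sh j x) (sub_nonneg.mpr h)
  simpa using this

theorem sh_le_iff (k : ℤ) {x y : B4} : sh k x ≤ y ↔ x ≤ sh (-k) y := by
  rw [← sh_le_sh (-k)]; simp

theorem le_sh_iff (k : ℤ) {x y : B4} : x ≤ sh k y ↔ sh (-k) x ≤ y := by
  rw [← sh_le_sh (-k)]; simp

theorem sh_inf (k : ℤ) (x y : B4) : sh k (x ⊓ y) = sh k x ⊓ sh k y := by
  apply le_antisymm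
  · exact le_inf ((sh_le_sh k).mpr inf_le_left) ((sh_le_sh k).mpr inf_le_right)
  · rw [le_sh_iff]
    apply le_inf
    · rw [← le_sh_iff]; exact inf_le_left
    · rw [← le_sh_iff]; exact inf_le_right

/-! ### The graph on the cosets of the subgroup generated by `δ` -/

abbrev V : Type := B4 ⧸ Subgroup.zpowers δ

/-- The vertex represented by a group element. -/
def vert (x : B4) : V := QuotientGroup.mk x

theorem vert_surjective (v : V) : ∃ x, vert x = v := QuotientGroup.mk_surjective v

theorem vert_eq_iff {x y : B4} : vert x = vert y ↔ ∃ k, y = sh k x := by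
  rw [vert, vert, QuotientGroup.eq, Subgroup.mem_zpowers_iff]
  simp only [sh]
  exact exists_congr fun k => by rw [eq_inv_mul_iff_mul_eq, eq_comm]

@[simp] theorem vert_sh (k : ℤ) (x : B4) : vert (sh k x) = vert x :=
  (vert_eq_iff.mpr ⟨k, rfl⟩).symm

theorem smul_vert (g x : B4) : g • vert x = vert (g * x) := rfl

/-- The graph distance between two cosets. -/
noncomputable def gd (v w : V) : ℕ :=
  sInf {m : ℕ | ∃ x y, vert x = v ∧ vert y = w ∧ x ≤ y ∧ y ≤ sh m x}

theorem gd_le {x y : B4} {m : ℕ} (h1 : x ≤ y) (h2 : y ≤ sh m x) : gd (vert x) (vert y) ≤ m :=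
  Nat.sInf_le ⟨x, y, rfl, rfl, h1, h2⟩

theorem exists_lift {x : B4} {w : V} {m : ℕ} (h : gd (vert x) w ≤ m) :
    ∃ y, vert y = w ∧ x ≤ y ∧ y ≤ sh m x := by
  have hne : {m : ℕ | ∃ x' y, vert x' = vert x ∧ vert y = w ∧ x' ≤ y ∧ y ≤ sh m x'}.Nonempty := by
    obtain ⟨y, rfl⟩ := vert_surjective w
    obtain ⟨n, h1, h2⟩ := exists_between (x⁻¹ * y)
    have h1 := (mul_le_mul_left_iff x).mpr h1
    have h2 := (mul_le_mul_left_iff x).mpr h2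
    rw [mul_inv_cancel_left] at h1 h2
    refine ⟨2 * n, x, sh n y, rfl, vert_sh _ _, ?_, ?_⟩
    · rw [le_sh_iff]; exact h1
    · rw [sh_le_iff, sh_sh]
      convert h2 using 1
      simp [sh, two_mul]
  obtain ⟨x', y, h1, h2, h3, h4⟩ := Nat.sInf_mem hne
  obtain ⟨k, rfl⟩ := vert_eq_iff.mp h1
  refine ⟨sh k y, by simpa using h2, by simpa using h3, ?_⟩
  have h5 : sh (gd (vert x') w : ℤ) x' ≤ sh m x' := sh_mono_left (by
    simpa using h) _
  have h6 : y ≤ sh m x' := by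
    refine le_trans ?_ h5
    simpa [gd] using h4
  have := (sh_le_sh k).mpr h6
  simpa [add_comm] using this

theorem gd_le_symm (v w : V) : gd w v ≤ gd v w := by
  obtain ⟨x, rfl⟩ := vert_surjective v
  obtain ⟨y, rfl, h1, h2⟩ := exists_lift (le_refl (gd (vert x) w))
  have := gd_le (x := y) (y := sh (gd (vert x) (vert y)) x) h2 ((sh_le_sh _).mpr h1)
  simpa using this

theorem gd_comm (v w : V) : gd v w = gd w v := le_antisymm (gd_le_symm _ _) (gd_le_symm _ _)

theorem gd_triangle (u v w : V) : gd u w ≤ gd u v + gd v w := by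
  obtain ⟨x, rfl⟩ := vert_surjective u
  obtain ⟨y, rfl, h1, h2⟩ := exists_lift (le_refl (gd (vert x) v))
  obtain ⟨z, rfl, h3, h4⟩ := exists_lift (le_refl (gd (vert y) w))
  refine gd_le (h1.trans h3) (h4.trans ?_)
  have := (sh_le_sh (gd (vert y) (vert z))).mpr h2
  simpa using this

@[simp] theorem gd_self (v : V) : gd v v = 0 := by
  obtain ⟨x, rfl⟩ := vert_surjective v
  exact Nat.le_zero.mp (gd_le le_rfl (by simp))

theorem eq_of_gd_eq_zero {v w : V} (h : gd v w = 0) : v = w := by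
  obtain ⟨x, rfl⟩ := vert_surjective v
  obtain ⟨y, rfl, h1, h2⟩ := exists_lift h.le
  rw [le_antisymm h1 (by simpa using h2)]

theorem gd_smul_le (g : B4) (v w : V) : gd (g • v) (g • w) ≤ gd v w := by
  obtain ⟨x, rfl⟩ := vert_surjective v
  obtain ⟨y, rfl, h1, h2⟩ := exists_lift (le_refl (gd (vert x) w))
  rw [smul_vert, smul_vert]
  refine gd_le ((mul_le_mul_left_iff g).mpr h1) ?_
  rw [← mul_sh]
  exact (mul_le_mul_left_iff g).mpr h2

theorem gd_smul (g : B4) (v w : V) : gd (g • v) (g • w) = gd v w := by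
  refine le_antisymm (gd_smul_le g v w) ?_
  have := gd_smul_le g⁻¹ (g • v) (g • w)
  simpa using this

/-- Every distance is realised through vertices at all intermediate levels. -/
theorem exists_pred {v w : V} {k : ℕ} (h : gd v w = k + 1) : ∃ q, gd v q = k ∧ gd q w = 1 := by
  obtain ⟨x, rfl⟩ := vert_surjective v
  obtain ⟨y, rfl, h1, h2⟩ := exists_lift h.le
  have h3 : gd (vert x) (vert (y ⊓ sh k x)) ≤ k :=
    gd_le (le_inf h1 (le_sh_of_nonneg _ (by positivity))) inf_le_right
  have h4 : gd (vert (y ⊓ sh k x)) (vert y) ≤ 1 := by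
    refine gd_le inf_le_left ?_
    rw [sh_inf]
    exact le_inf (le_sh_of_nonneg _ (by positivity)) (by simpa using h2)
  have h5 := gd_triangle (vert x) (vert (y ⊓ sh k x)) (vert y)
  exact ⟨vert (y ⊓ sh k x), by omega, by omega⟩

/-- `y` is the representative above `x` of a vertex at distance exactly `k` from `x`. -/
def Lift (x : B4) (k : ℕ) (y : B4) : Prop := x ≤ y ∧ y ≤ sh k x ∧ gd (vert x) (vert y) = k

theorem exists_isLift {x : B4} {v : V} {k : ℕ} (h : gd (vert x) v = k) :
    ∃ y, vert y = v ∧ Lift x k y := by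
  obtain ⟨y, rfl, h1, h2⟩ := exists_lift h.le
  exact ⟨y, rfl, h1, h2, h⟩

theorem Lift.not_sh_le {x y : B4} {k : ℕ} (h : Lift x k y) : ¬ sh 1 x ≤ y := by
  intro h1
  obtain ⟨-, h2, h3⟩ := h
  cases k with
  | zero =>
    have := deg_mono (h1.trans h2)
    simp at this
  | succ k =>
    have h4 : gd (vert x) (vert (sh (-1) y)) ≤ k := by
      refine gd_le ((sh_le_iff 1).mp h1) ?_
      rw [sh_le_iff]
      simpa using h2
    rw [vert_sh] at h4
    omega

theorem Lift.not_le_sh {x y : B4} {k : ℕ} (h : Lift x (k + 1) y) : ¬ y ≤ sh k x := by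
  intro h1
  have := gd_le h.1 h1
  have := h.2.2
  omega

theorem Lift.same_level {x v w : B4} {k : ℕ} (hv : Lift x k v) (hw : Lift x k w)
    (h : gd (vert v) (vert w) ≤ 1) : (v ≤ w ∧ w ≤ sh 1 v) ∨ (w ≤ v ∧ v ≤ sh 1 w) := by
  obtain ⟨w', h1, h2, h3⟩ := exists_lift h
  obtain ⟨j, rfl⟩ := vert_eq_iff.mp h1
  rcases lt_trichotomy j 0 with hj | rfl | hj
  · have hj' : j = -1 := by
      by_contra hne
      apply hv.not_sh_le
      have h4 : sh 2 x ≤ w' := by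
        have := (sh_le_iff (-j)).mpr (by simpa using hw.1)
        exact (sh_mono_left (by omega) x).trans this
      have h5 := h4.trans h3
      rw [← sh_le_sh (Nat.cast 1)]
      simpa using h5
    subst hj'
    right
    refine ⟨?_, by simpa using h2⟩
    rw [sh_le_iff]
    simpa using h3
  · left
    simpa using ⟨h2, h3⟩
  · exfalso
    apply hw.not_sh_le
    calc sh 1 x ≤ sh j x := sh_mono_left (by omega) x
      _ ≤ sh j v := (sh_le_sh j).mpr hv.1
      _ ≤ sh j w' := (sh_le_sh j).mpr h2

theorem Lift.unique {x v w : B4} {k : ℕ} (hv : Lift x k v) (hw : Lift x k w)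
    (h : vert v = vert w) : v = w := by
  obtain ⟨j, rfl⟩ := vert_eq_iff.mp h
  rcases lt_trichotomy j 0 with hj | rfl | hj
  · exfalso
    apply hv.not_sh_le
    have := (sh_le_iff (-j)).mpr (by simpa using hw.1)
    exact (sh_mono_left (by omega) x).trans this
  · simp
  · exfalso
    apply hw.not_sh_le
    exact (sh_mono_left (by omega) x).trans ((sh_le_sh j).mpr hv.1)

theorem Lift.next_level {x v w : B4} {k : ℕ} (hv : Lift x (k + 1) v) (hw : Lift x k w)
    (h : gd (vert w) (vert v) ≤ 1) : w ≤ v ∧ v ≤ sh 1 w := by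
  obtain ⟨v', h1, h2, h3⟩ := exists_lift h
  obtain ⟨j, rfl⟩ := vert_eq_iff.mp h1
  rcases lt_trichotomy j 0 with hj | rfl | hj
  · exfalso
    apply hv.not_le_sh
    calc sh j v' ≤ sh (-1) v' := sh_mono_left (by omega) _
      _ ≤ w := by rw [sh_le_iff]; simpa using h3
      _ ≤ sh k x := hw.2.1
  · simpa using ⟨h2, h3⟩
  · exfalso
    apply hv.not_sh_le
    calc sh 1 x ≤ sh j x := sh_mono_left (by omega) x
      _ ≤ sh j w := (sh_le_sh j).mpr hw.1
      _ ≤ sh j v' := (sh_le_sh j).mpr h2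

/-- Triangle condition. -/
theorem triangle_condition {u v w : V} {k : ℕ} (hv : gd u v = k + 1) (hw : gd u w = k + 1)
    (h : gd v w = 1) : ∃ q, gd u q = k ∧ gd q v = 1 ∧ gd q w = 1 := by
  obtain ⟨x, rfl⟩ := vert_surjective u
  obtain ⟨y, rfl, hy⟩ := exists_isLift hv
  obtain ⟨z, rfl, hz⟩ := exists_isLift hw
  have key : ∀ y z, Lift x (k + 1) y → Lift x (k + 1) z → y ≤ z → z ≤ sh 1 y →
      ∃ q, gd (vert x) q = k ∧ gd q (vert y) = 1 ∧ gd q (vert z) = 1 := by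
    intro y z hy hz h1 h2
    have h3 : gd (vert x) (vert (y ⊓ sh k x)) ≤ k :=
      gd_le (le_inf hy.1 (le_sh_of_nonneg _ (by positivity))) inf_le_right
    have h4 : ∀ t, y ≤ t → t ≤ sh 1 y → Lift x (k + 1) t →
        gd (vert (y ⊓ sh k x)) (vert t) ≤ 1 := by
      intro t h5 h6 h7
      refine gd_le (inf_le_left.trans h5) ?_
      rw [sh_inf]
      exact le_inf h6 (by simpa using h7.2.1)
    have h5 := h4 y le_rfl (le_sh_of_nonneg _ (by positivity)) hy
    have h6 := h4 z h1 h2 hz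
    have h7 := gd_triangle (vert x) (vert (y ⊓ sh k x)) (vert y)
    have h8 := gd_triangle (vert x) (vert (y ⊓ sh k x)) (vert z)
    have h9 := hy.2.2
    have h10 := hz.2.2
    exact ⟨vert (y ⊓ sh k x), by omega, by omega, by omega⟩
  rcases hy.same_level hz h.le with ⟨h1, h2⟩ | ⟨h1, h2⟩
  · exact key y z hy hz h1 h2
  · obtain ⟨q, h3, h4, h5⟩ := key z y hz hy h1 h2
    exact ⟨q, h3, h5, h4⟩

/-- Two distinct predecessors of a vertex are adjacent. -/
theorem pred_adjacent {u z v w : V} {k : ℕ} (gz : gd u z = k + 1) (gv : gd u v = k)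
    (gw : gd u w = k) (hzv : gd z v = 1) (hzw : gd z w = 1) (hne : v ≠ w) : gd v w = 1 := by
  obtain ⟨x, rfl⟩ := vert_surjective u
  obtain ⟨z, rfl, hz⟩ := exists_isLift gz
  obtain ⟨v, rfl, hv⟩ := exists_isLift gv
  obtain ⟨w, rfl, hw⟩ := exists_isLift gw
  rw [gd_comm] at hzv hzw
  obtain ⟨h1, h2⟩ := hz.next_level hv hzv.le
  obtain ⟨h3, h4⟩ := hz.next_level hw hzw.le
  have hne' : v ≠ w := fun h => hne (by rw [h])
  have hpos : 0 < gd (vert v) (vert w) :=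
    Nat.pos_of_ne_zero fun h => hne (eq_of_gd_eq_zero h)
  by_cases hvw : v ≤ w
  · have := gd_le hvw (m := 1) (by simpa using h3.trans h2)
    omega
  by_cases hwv : w ≤ v
  · have := gd_le hwv (m := 1) (by simpa using h1.trans h4)
    rw [gd_comm] at this
    omega
  exfalso
  have d1 : deg (v ⊓ w) < deg v := deg_lt inf_le_left fun h => hvw (h ▸ inf_le_right)
  have d2 : deg v < deg (z ⊓ sh k x) := by
    refine deg_lt (le_inf h1 hv.2.1) fun h => hwv ?_
    rw [h]; exact le_inf h3 hw.2.1
  have d3 : deg (z ⊓ sh k x) < deg z :=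
    deg_lt inf_le_left fun h => hz.not_le_sh (h ▸ inf_le_right)
  have h5 : z ≤ sh 1 (v ⊓ w) := by rw [sh_inf]; exact le_inf h2 h4
  have d4 : deg z < deg (sh 1 (v ⊓ w)) := by
    refine deg_lt h5 fun h => hz.not_sh_le ?_
    rw [h, sh_le_sh]; exact le_inf hv.1 hw.1
  rw [deg_sh] at d4
  omega

theorem adjacent_ne {x y : B4} (h : gd (vert x) (vert y) = 1) : x ≠ y := by
  rintro rfl; simp at h

/-- No triangle is equidistant from a vertex other than itself. -/
theorem no_level_triangle {u p q r : V} {k : ℕ} (gp : gd u p = k + 1) (gq : gd u q = k + 1)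
    (gr : gd u r = k + 1) (hpq : gd p q = 1) (hpr : gd p r = 1) (hqr : gd q r = 1) : False := by
  obtain ⟨x, rfl⟩ := vert_surjective u
  obtain ⟨p, rfl, hp⟩ := exists_isLift gp
  obtain ⟨q, rfl, hq⟩ := exists_isLift gq
  obtain ⟨r, rfl, hr⟩ := exists_isLift gr
  have key : ∀ p q r, Lift x (k + 1) p → Lift x (k + 1) r → p ≤ q → q ≤ r → r ≤ sh 1 p →
      p ≠ q → q ≠ r → False := by
    intro p q r hp hr h1 h2 h3 h4 h5
    have d1 : deg (p ⊓ sh k x) < deg p :=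
      deg_lt inf_le_left fun h => hp.not_le_sh (h ▸ inf_le_right)
    have d2 := deg_lt h1 h4
    have d3 := deg_lt h2 h5
    have d4 : deg r < deg (sh 1 (p ⊓ sh k x)) := by
      refine deg_lt ?_ fun h => hr.not_sh_le ?_
      · rw [sh_inf]; exact le_inf h3 (by simpa using hr.2.1)
      · rw [h, sh_le_sh]; exact le_inf hp.1 (le_sh_of_nonneg _ (by positivity))
    rw [deg_sh] at d4
    omega
  have n1 := adjacent_ne hpq
  have n2 := adjacent_ne hpr
  have n3 := adjacent_ne hqr
  rcases hp.same_level hq hpq.le with ⟨a1, a2⟩ | ⟨a1, a2⟩ <;>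
  rcases hp.same_level hr hpr.le with ⟨b1, b2⟩ | ⟨b1, b2⟩ <;>
  rcases hq.same_level hr hqr.le with ⟨c1, c2⟩ | ⟨c1, c2⟩
  · exact key p q r hp hr a1 c1 b2 n1 n3
  · exact key p r q hp hq b1 c1 a2 n2 n3.symm
  · exact n1 (le_antisymm a1 (c1.trans b1))
  · exact key r p q hr hq b1 a1 c2 n2.symm n1
  · exact key q p r hq hr a1 b1 c2 n1.symm n2
  · exact n1 (le_antisymm (b1.trans c1) a1)
  · exact key q r p hq hp c1 b1 a2 n3 n2.symm
  · exact key r q p hr hp c1 a1 b2 n3.symm n1.symm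

/-- The link of a vertex contains no square. -/
theorem no_square {v p q w w' : V} (gp : gd v p = 1) (gq : gd v q = 1) (gw : gd v w = 1)
    (gw' : gd v w' = 1) (hpw : gd p w = 1) (hpw' : gd p w' = 1) (hqw : gd q w = 1)
    (hqw' : gd q w' = 1) (hpq : p ≠ q) (hne : w ≠ w') : False := by
  obtain ⟨x, rfl⟩ := vert_surjective v
  obtain ⟨p, rfl, hp⟩ := exists_isLift gp
  obtain ⟨q, rfl, hq⟩ := exists_isLift gq
  obtain ⟨w, rfl, hw⟩ := exists_isLift gw
  obtain ⟨w', rfl, hw'⟩ := exists_isLift gw'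
  have hr : ∀ y, Lift x 1 y → deg x < deg y ∧ deg y < deg x + 3 := by
    intro y hy
    refine ⟨deg_lt hy.1 fun h => ?_, ?_⟩
    · have := hy.2.2
      rw [h] at this; simp at this
    · have := deg_lt hy.2.1 fun h => hy.not_sh_le (by rw [h]; simp)
      simpa using this
  have key : ∀ p q w w', Lift x 1 p → Lift x 1 q → Lift x 1 w → Lift x 1 w' →
      p ≤ w → p ≤ w' → q ≤ w → q ≤ w' → p ≠ q → w ≠ w' → p ≠ w → q ≠ w → p ≠ w' → False := by
    intro p q w w' hp hq hw hw' h1 h2 h3 h4 h5 h6 h7 h8 h9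
    have d1 := deg_lt h1 h7
    have d2 := deg_lt h3 h8
    have d3 := deg_lt h2 h9
    have e1 : deg (w ⊓ w') < deg w := deg_lt inf_le_left fun h => by
      have h10 : w ≤ w' := h ▸ inf_le_right
      have := deg_lt h10 h6
      have := hr w hw; have := hr w' hw'; have := hr p hp
      omega
    have h11 := hr p hp
    have h12 := hr q hq
    have h13 := hr w hw
    have f1 : p = w ⊓ w' := eq_of_le_of_deg (le_inf h1 h2) (by omega)
    have f2 : q = w ⊓ w' := eq_of_le_of_deg (le_inf h3 h4) (by omega)
    exact h5 (f1.trans f2.symm)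
  have n1 := adjacent_ne hpw
  have n2 := adjacent_ne hpw'
  have n3 := adjacent_ne hqw
  have n4 := adjacent_ne hqw'
  have n5 : p ≠ q := fun h => hpq (by rw [h])
  have n6 : w ≠ w' := fun h => hne (by rw [h])
  have c1 := hp.same_level hw hpw.le
  have c2 := hp.same_level hw' hpw'.le
  have c3 := hq.same_level hw hqw.le
  have c4 := hq.same_level hw' hqw'.le
  have r1 := hr p hp
  have r2 := hr q hq
  have r3 := hr w hw
  have r4 := hr w' hw'
  rcases c1 with ⟨a1, -⟩ | ⟨a1, -⟩
  · have e1 := deg_lt a1 n1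
    have a2 : p ≤ w' := c2.elim And.left fun h => by have := deg_lt h.1 n2.symm; omega
    have e2 := deg_lt a2 n2
    have a3 : q ≤ w := c3.elim And.left fun h => by have := deg_lt h.1 n3.symm; omega
    have a4 : q ≤ w' := c4.elim And.left fun h => by have := deg_lt h.1 n4.symm; omega
    exact key p q w w' hp hq hw hw' a1 a2 a3 a4 n5 n6 n1 n3 n2
  · have e1 := deg_lt a1 n1.symm
    have a2 : w' ≤ p := c2.elim (fun h => by have := deg_lt h.1 n2; omega) And.left
    have a3 : w ≤ q := c3.elim (fun h => by have := deg_lt h.1 n3; omega) And.left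
    have a4 : w' ≤ q := c4.elim (fun h => by
      have := deg_lt h.1 n4; have := deg_lt a2 n2.symm; omega) And.left
    exact key w w' p q hw hw' hp hq a1 a3 a2 a4 n6 n5 n1.symm n2.symm n3.symm

theorem lt_inf_sh {p v : B4} (h : p ≤ v) (hne : p ≠ v) : deg p < deg (v ⊓ sh 1 p) := by
  obtain ⟨K, hK⟩ := h
  obtain ⟨L, hL, hv⟩ := exists_isNormal_of_one_le (one_le_wordVal K)
  rw [← hv] at hK
  cases L with
  | nil => simp at hK; exact absurd hK.symm hne
  | cons s L =>
    have hs := hL.2 s (by simp)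
    have h1 : p * val s ≤ v ⊓ sh 1 p := by
      refine le_inf ⟨L, by rw [hK, wordVal_cons, mul_assoc]⟩ ?_
      rw [sh, zpow_one, mul_le_mul_left_iff]
      exact val_le_delta s
    have h2 := deg_mono h1
    rw [deg_mul, deg_val] at h2
    have := rank_pos s hs
    omega

/-- Two vertices of an interval at the same level are comparable. -/
theorem interval_comparable {x z v w : B4} {k m : ℕ} (hz : Lift x (k + m) z) (hv : Lift x k v)
    (hw : Lift x k w) (hvz : gd (vert v) (vert z) = m) (hwz : gd (vert w) (vert z) = m) :
    v ≤ w ∨ w ≤ v := by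
  have habove : ∀ v, Lift x k v → gd (vert v) (vert z) = m → v ≤ z ∧ z ≤ sh m v := by
    intro v hv hvz
    obtain ⟨z', h1, h2, h3⟩ := exists_lift hvz.le
    have h4 : Lift x (k + m) z' := by
      refine ⟨hv.1.trans h2, h3.trans ?_, by rw [h1]; exact hz.2.2⟩
      have := (sh_le_sh m).mpr hv.2.1
      simpa using this
    rw [hz.unique h4 h1.symm]
    exact ⟨h2, h3⟩
  obtain ⟨v1, v2⟩ := habove v hv hvz
  obtain ⟨w1, w2⟩ := habove w hw hwz
  cases k with
  | zero =>
    left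
    exact (by simpa using hv.2.1 : v ≤ x).trans hw.1
  | succ k =>
    by_contra hcon
    push Not at hcon
    obtain ⟨hvw, hwv⟩ := hcon
    have dv := lt_inf_sh (inf_le_left : v ⊓ w ≤ v) fun h => hvw (h ▸ inf_le_right)
    have dw := lt_inf_sh (inf_le_right : v ⊓ w ≤ w) fun h => hwv (h ▸ inf_le_left)
    set p := v ⊓ w with hp
    have hxp : x ≤ p := le_inf hv.1 hw.1
    set t := sh 1 (p ⊓ sh k x) ⊓ z with ht
    have tv : v ⊓ sh 1 p ≤ t := by
      rw [ht, sh_inf 1 p]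
      exact le_inf (le_inf inf_le_right (inf_le_left.trans (by simpa using hv.2.1)))
        (inf_le_left.trans v1)
    have tw : w ⊓ sh 1 p ≤ t := by
      rw [ht, sh_inf 1 p]
      exact le_inf (le_inf inf_le_right (inf_le_left.trans (by simpa using hw.2.1)))
        (inf_le_left.trans w1)
    have dt : deg (v ⊓ sh 1 p) < deg t := by
      refine deg_lt tv fun h => ?_
      have h1 : w ⊓ sh 1 p ≤ p := le_inf ((h ▸ tw).trans inf_le_left) inf_le_left
      have := deg_mono h1
      omega
    by_cases hq : p ≤ sh k x
    · have h1 : z ≤ sh m p := by rw [hp, sh_inf]; exact le_inf v2 w2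
      have h2 : z ≤ sh (k + m : ℕ) x := by
        have := h1.trans ((sh_le_sh m).mpr hq)
        simpa using this
      have h3 := gd_le hz.1 h2
      have := hz.2.2
      omega
    · have d1 : deg (p ⊓ sh k x) < deg p := deg_lt inf_le_left fun h => hq (h ▸ inf_le_right)
      have h1 : t = sh 1 (p ⊓ sh k x) := eq_of_le_of_deg inf_le_left (by rw [deg_sh]; omega)
      have h2 : sh 1 (p ⊓ sh k x) ≤ z := h1 ▸ inf_le_right
      refine hz.not_sh_le (le_trans ?_ h2)
      rw [sh_le_sh]
      exact le_inf hxp (le_sh_of_nonneg _ (by positivity))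

/-! ### Intervals and metric triangles -/

/-- `q` lies on a geodesic from `u` to `v`. -/
def Btw (u v q : V) : Prop := gd u q + gd q v = gd u v

theorem Btw.symm {u v q : V} (h : Btw u v q) : Btw v u q := by
  unfold Btw at *
  rw [gd_comm v q, gd_comm q u, gd_comm v u]; omega

theorem btw_left (u v : V) : Btw u v u := by simp [Btw]

theorem btw_right (u v : V) : Btw u v v := by simp [Btw]

theorem Btw.trans {u v p q : V} (h : Btw u v p) (h' : Btw u p q) : Btw u v q := by
  unfold Btw at *
  have := gd_triangle u q v
  have := gd_triangle q p v
  omega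

theorem exists_level {v w : V} {k : ℕ} (hk : k ≤ gd v w) : ∃ q, gd v q = k ∧ Btw v w q := by
  obtain ⟨j, hj⟩ := Nat.exists_eq_add_of_le hk
  induction j generalizing w with
  | zero => exact ⟨w, by omega, btw_right _ _⟩
  | succ j ih =>
    obtain ⟨q, h1, h2⟩ := exists_pred (k := k + j) (by omega)
    obtain ⟨r, h3, h4⟩ := ih (w := q) (by omega) h1
    exact ⟨r, h3, Btw.trans (by unfold Btw; omega) h4⟩

theorem exists_succ {v w : V} (h : v ≠ w) : ∃ p, gd v p = 1 ∧ Btw v w p := by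
  have : gd v w ≠ 0 := fun h' => h (eq_of_gd_eq_zero h')
  exact exists_level (by omega)

/-- The distance to a fixed vertex has no strict local minima along intervals. -/
theorem exists_descent (u : V) (n : ℕ) : ∀ v w : V, gd v w = n → gd u w < gd u v →
    ∃ p, gd v p = 1 ∧ Btw v w p ∧ gd u p < gd u v := by
  induction n with
  | zero =>
    intro v w h h'
    rw [eq_of_gd_eq_zero h] at h'
    omega
  | succ n ih =>
    intro v w h h'
    obtain ⟨p, h1, h2⟩ := exists_succ (v := v) (w := w) (by rintro rfl; simp at h)
    by_cases hlt : gd u p < gd u v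
    · exact ⟨p, h1, h2, hlt⟩
    have h3 : gd p w = n := by unfold Btw at h2; omega
    obtain ⟨q, h4, h5, h6⟩ := ih p w h3 (by omega)
    have t1 := gd_triangle u v p
    have t2 := gd_triangle u q p
    rw [gd_comm q p] at t2
    have t3 := gd_triangle v q w
    have hqw : gd p q + gd q w = gd p w := h5
    have hvq : gd v q ≠ 1 := by omega
    by_cases heq : gd u p = gd u v
    · obtain ⟨r, h7, h8, h9⟩ := triangle_condition (u := u) (v := v) (w := p) (k := gd u q)
        (by omega) (by omega) h1
      by_cases hrq : r = q
      · subst hrq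
        rw [gd_comm] at h8
        exact absurd h8 hvq
      · have h10 := pred_adjacent (u := u) (z := p) (k := gd u q) (by omega) h7 rfl
          (by rw [gd_comm]; exact h9) h4 hrq
        refine ⟨r, by rw [gd_comm]; exact h8, ?_, by omega⟩
        rw [gd_comm] at h8
        have t4 := gd_triangle r q w
        have t5 := gd_triangle v r w
        unfold Btw
        omega
    · have hne : v ≠ q := by rintro rfl; simp at t3; omega
      have := pred_adjacent (u := u) (z := p) (v := v) (w := q) (k := gd u v) (by omega) rfl
        (by omega) (by rw [gd_comm]; exact h1) h4 hne
      omega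

/-- A triple of vertices whose pairwise intervals only meet at the common end points. -/
structure MetricTriangle (α β γ : V) : Prop where
  fst : ∀ q, Btw α β q → Btw α γ q → q = α
  snd : ∀ q, Btw β α q → Btw β γ q → q = β
  thd : ∀ q, Btw γ α q → Btw γ β q → q = γ

theorem exists_farthest (u v w : V) : ∃ α, Btw u v α ∧ Btw u w α ∧
    ∀ q, Btw u v q → Btw u w q → gd u q ≤ gd u α := by
  classical
  let P : ℕ → Prop := fun k => ∃ α, Btw u v α ∧ Btw u w α ∧ gd u α = k
  have h0 : P 0 := ⟨u, btw_left _ _, btw_left _ _, by simp⟩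
  have h1 := Nat.findGreatest_spec (P := P) (Nat.zero_le (gd u v)) h0
  obtain ⟨α, h2, h3, h4⟩ := h1
  refine ⟨α, h2, h3, fun q h5 h6 => ?_⟩
  rw [h4]
  refine Nat.le_findGreatest ?_ ⟨q, h5, h6, rfl⟩
  unfold Btw at h5; omega

/-- Every triple of vertices spans a metric triangle. -/
theorem exists_metricTriangle (x y z : V) : ∃ α β γ, MetricTriangle α β γ ∧
    gd x α + gd α β + gd β y = gd x y ∧ gd x α + gd α γ + gd γ z = gd x z ∧
    gd y β + gd β γ + gd γ z = gd y z := by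
  obtain ⟨α, a1, a2, a3⟩ := exists_farthest x y z
  obtain ⟨β, b1, b2, b3⟩ := exists_farthest y α z
  obtain ⟨γ, c1, c2, c3⟩ := exists_farthest z α β
  have e1 : gd x α + gd α β + gd β y = gd x y := by
    have := b1.symm; unfold Btw at this a1; omega
  have e2 : gd x α + gd α γ + gd γ z = gd x z := by
    have := c1.symm; unfold Btw at this a2; omega
  have e3 : gd y β + gd β γ + gd γ z = gd y z := by
    have := c2.symm; unfold Btw at this b2; omega
  refine ⟨α, β, γ, ⟨fun q h1 h2 => ?_, fun q h1 h2 => ?_, fun q h1 h2 => ?_⟩, e1, e2, e3⟩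
  · have t1 := gd_triangle x α q
    have t2 := gd_triangle x q y
    have t3 := gd_triangle q β y
    have t4 := gd_triangle x q z
    have t5 := gd_triangle q γ z
    unfold Btw at h1 h2
    have := a3 q (by unfold Btw; omega) (by unfold Btw; omega)
    exact (eq_of_gd_eq_zero (by omega)).symm
  · have t1 := gd_triangle y β q
    have t2 := gd_triangle y q α
    have t4 := gd_triangle y q z
    have t5 := gd_triangle q γ z
    unfold Btw at h1 h2 b1
    have := b3 q (by unfold Btw; omega) (by unfold Btw; omega)
    exact (eq_of_gd_eq_zero (by omega)).symm
  · have t1 := gd_triangle z γ q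
    have t2 := gd_triangle z q α
    have t4 := gd_triangle z q β
    unfold Btw at h1 h2 c1 c2
    have := c3 q (by unfold Btw; omega) (by unfold Btw; omega)
    exact (eq_of_gd_eq_zero (by omega)).symm

namespace MetricTriangle

variable {α β γ : V}

theorem rotate (h : MetricTriangle α β γ) : MetricTriangle γ α β where
  fst q h1 h2 := h.thd q h1 h2
  snd q h1 h2 := h.fst q h2 h1
  thd q h1 h2 := h.snd q h2 h1

theorem swap (h : MetricTriangle α β γ) : MetricTriangle α γ β where
  fst q h1 h2 := h.fst q h2 h1
  snd q h1 h2 := h.thd q h1 h2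
  thd q h1 h2 := h.snd q h1 h2

theorem gd_le_of_descent (h : MetricTriangle α β γ) {w : V} (hw : Btw β γ w) :
    gd α β ≤ gd α w := by
  by_contra hlt
  obtain ⟨p, h1, h2, h3⟩ := exists_descent α _ β w rfl (by omega)
  have t := gd_triangle α p β
  rw [gd_comm p β] at t
  have : p = β := by
    refine h.snd p (Btw.symm ?_) (hw.trans h2)
    unfold Btw
    rw [gd_comm p β]; omega
  subst this
  simp at h1

theorem gd_eq (h : MetricTriangle α β γ) : gd α β = gd α γ :=
  le_antisymm (h.gd_le_of_descent (btw_right _ _)) (h.swap.gd_le_of_descent (btw_right _ _))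

/-- The distance to a corner is constant on the opposite side. -/
theorem gd_const (h : MetricTriangle α β γ) {w : V} (hw : Btw β γ w) : gd α w = gd α β := by
  refine le_antisymm ?_ (h.gd_le_of_descent hw)
  by_contra hlt
  have e := h.gd_eq
  obtain ⟨p, h1, h2, h3⟩ := exists_descent α _ w β rfl (by omega)
  obtain ⟨q, h4, h5, h6⟩ := exists_descent α _ w γ rfl (by omega)
  have t1 := gd_triangle α p w
  have t2 := gd_triangle α q w
  have t3 := gd_triangle β p γ
  have t4 := gd_triangle p q γ
  rw [gd_comm p w] at t1
  rw [gd_comm q w] at t2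
  unfold Btw at h2 h5 hw
  rw [gd_comm p β, gd_comm w β] at h2
  have hne : p ≠ q := by rintro rfl; simp at t4; omega
  have := pred_adjacent (u := α) (k := gd α p) (by omega) rfl (by omega) h1 h4 hne
  omega

/-- Sides of a metric triangle are unique geodesics. -/
theorem side_unique (h : MetricTriangle α β γ) {v w : V} (hv : Btw β γ v) (hw : Btw β γ w)
    (hvw : gd β v = gd β w) : v = w := by
  obtain ⟨i, hi⟩ : ∃ i, gd β v = i := ⟨_, rfl⟩
  induction i generalizing v w with
  | zero => exact (eq_of_gd_eq_zero hi).symm.trans (eq_of_gd_eq_zero (hvw ▸ hi))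
  | succ i ih =>
    obtain ⟨p, h1, h2⟩ := exists_pred hi
    obtain ⟨q, h3, h4⟩ := exists_pred (hvw ▸ hi)
    have hp : Btw β γ p := hv.trans (by unfold Btw; omega)
    have hq : Btw β γ q := hw.trans (by unfold Btw; omega)
    have hpq := ih hp hq (by omega) h1
    subst hpq
    by_contra hne
    have hv' := hv.symm
    have hw' := hw.symm
    have hp' := hp.symm
    unfold Btw at hv' hw' hp'
    rw [gd_comm v β] at hv'
    rw [gd_comm w β] at hw'
    rw [gd_comm p β] at hp'
    have hadj := pred_adjacent (u := γ) (z := p) (k := gd γ v) (by omega) rfl (by omega)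
      h2 h4 hne
    have e1 := h.gd_const hv
    have e2 := h.gd_const hw
    have e3 := h.gd_const hp
    have e4 := h.rotate.gd_eq
    have e5 := h.gd_eq
    rw [gd_comm] at e4
    have hpos : 0 < gd α β := by
      rw [Btw] at hv
      rw [gd_comm γ β] at e4
      omega
    obtain ⟨k, hk⟩ : ∃ k, gd α β = k + 1 := ⟨gd α β - 1, by omega⟩
    exact no_level_triangle (e3.trans hk) (e1.trans hk) (e2.trans hk) h2 h4 hadj

theorem sides (h : MetricTriangle α β γ) {n : ℕ} (hn : gd β γ = n) :
    gd α β = n ∧ gd α γ = n := by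
  have e4 := h.rotate.gd_eq
  have e5 := h.gd_eq
  rw [gd_comm γ α, gd_comm γ β] at e4
  omega

end MetricTriangle

/-! ### Flat triangles -/

/-- A parametrisation of an equilateral flat triangle with corners `α, β, γ`: the corner `β` is
`p 0 0`, the corner `γ` is `p 0 n` and the corner `α` is `p n 0`. -/
structure Flat (n : ℕ) (α β γ : V) (p : ℕ → ℕ → V) : Prop where
  tri : MetricTriangle α β γ
  dist_fst : ∀ h i, h + i ≤ n → gd α (p h i) + h = n
  dist_snd : ∀ h i, h + i ≤ n → gd β (p h i) = h + i
  dist_thd : ∀ h i, h + i ≤ n → gd γ (p h i) + i = n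
  row : ∀ h i, h + i + 1 ≤ n → gd (p h i) (p h (i + 1)) = 1
  up : ∀ h i, h + i + 1 ≤ n → gd (p h i) (p (h + 1) i) = 1
  diag : ∀ h i, h + i + 1 ≤ n → gd (p h (i + 1)) (p (h + 1) i) = 1

theorem exists_flat (n : ℕ) : ∀ α β γ : V, MetricTriangle α β γ → gd β γ = n →
    ∃ p, Flat n α β γ p := by
  induction n with
  | zero =>
    intro α β γ h hn
    obtain ⟨h1, h2⟩ := h.sides hn
    have h3 := eq_of_gd_eq_zero h1
    have h4 := eq_of_gd_eq_zero h2
    subst h3 h4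
    refine ⟨fun _ _ => α, h, ?_, ?_, ?_, ?_, ?_, ?_⟩ <;> intros <;> simp <;> omega
  | succ n ih =>
    intro α β γ h hn
    obtain ⟨s1, s2⟩ := h.sides hn
    have hv : ∀ i, ∃ v, i ≤ n + 1 → gd β v = i ∧ Btw β γ v := by
      intro i
      by_cases hi : i ≤ n + 1
      · obtain ⟨v, hv⟩ := exists_level (v := β) (w := γ) (k := i) (by omega)
        exact ⟨v, fun _ => hv⟩
      · exact ⟨α, fun h => absurd h hi⟩
    choose v hv using hv
    have vα : ∀ i, i ≤ n + 1 → gd α (v i) = n + 1 := fun i hi => by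
      rw [h.gd_const (hv i hi).2, s1]
    have vγ : ∀ i, i ≤ n + 1 → i + gd (v i) γ = n + 1 := fun i hi => by
      have h1 := (hv i hi).2
      unfold Btw at h1
      rw [(hv i hi).1, hn] at h1; exact h1
    have vadj : ∀ i, i ≤ n → gd (v i) (v (i + 1)) = 1 := by
      intro i hi
      obtain ⟨h1, h2⟩ := hv (i + 1) (by omega)
      obtain ⟨q, h3, h4⟩ := exists_pred h1
      have h5 : q = v i := h.side_unique (h2.trans (by unfold Btw; omega)) (hv i (by omega)).2
        (by rw [h3, (hv i (by omega)).1])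
      rw [← h5]; exact h4
    have hw : ∀ i, ∃ w, i ≤ n → gd α w = n ∧ gd w (v i) = 1 ∧ gd w (v (i + 1)) = 1 := by
      intro i
      by_cases hi : i ≤ n
      · obtain ⟨w, hw⟩ := triangle_condition (vα i (by omega)) (vα (i + 1) (by omega)) (vadj i hi)
        exact ⟨w, fun _ => hw⟩
      · exact ⟨α, fun h => absurd h hi⟩
    choose w hw using hw
    have v0 : v 0 = β := (eq_of_gd_eq_zero (hv 0 (by omega)).1).symm
    have vn : v (n + 1) = γ := eq_of_gd_eq_zero (by have := vγ (n + 1) le_rfl; omega)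
    have wadj : ∀ i, i + 1 ≤ n → gd (w i) (w (i + 1)) = 1 := by
      intro i hi
      obtain ⟨a1, a2, a3⟩ := hw i (by omega)
      obtain ⟨b1, b2, b3⟩ := hw (i + 1) hi
      refine pred_adjacent (u := α) (z := v (i + 1)) (vα (i + 1) (by omega)) a1 b1
        (by rw [gd_comm]; exact a3) (by rw [gd_comm]; exact b2) fun heq => ?_
      rw [← heq] at b3
      have t1 := gd_triangle β (v i) (w i)
      have t2 := gd_triangle (w i) (v (i + 1 + 1)) γ
      have t3 := gd_triangle β (w i) γ
      have t4 := vγ (i + 1 + 1) (by omega)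
      have t5 := (hv i (by omega)).1
      have t6 := (hv (i + 1) (by omega)).1
      rw [gd_comm (v i)] at t1
      have := h.side_unique (v := w i) (w := v (i + 1)) (by unfold Btw; omega)
        (hv (i + 1) (by omega)).2 (by omega)
      rw [this] at a3
      simp at a3
    have wpath : ∀ i j, i + j ≤ n → gd (w i) (w (i + j)) ≤ j := by
      intro i j hj
      induction j with
      | zero => simp
      | succ j ihj =>
        have t := gd_triangle (w i) (w (i + j)) (w (i + (j + 1)))
        have := wadj (i + j) (by omega)
        rw [← add_assoc] at *
        have := ihj (by omega)
        omega
    obtain ⟨a1, a2, a3⟩ := hw 0 (by omega)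
    obtain ⟨b1, b2, b3⟩ := hw n le_rfl
    rw [v0] at a2
    rw [vn] at b3
    have cw0 : Btw β α (w 0) := by unfold Btw; rw [gd_comm β, gd_comm _ α, gd_comm β α]; omega
    have cwn : Btw γ α (w n) := by unfold Btw; rw [gd_comm γ, gd_comm _ α, gd_comm γ α]; omega
    have cβ : ∀ q, Btw γ α q → gd β q = n + 1 := fun q hq => by
      rw [h.rotate.rotate.gd_const hq, hn]
    have cγ : ∀ q, Btw β α q → gd γ q = n + 1 := fun q hq => by
      rw [h.swap.rotate.rotate.gd_const hq, gd_comm, hn]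
    have far0 : ∀ q, Btw β α q → n ≤ gd q (w n) := by
      intro q hq
      have := gd_triangle q (w n) γ
      have := cγ q hq
      rw [gd_comm] at this
      omega
    have farn : ∀ q, Btw γ α q → n ≤ gd q (w 0) := by
      intro q hq
      have := gd_triangle q (w 0) β
      have := cβ q hq
      rw [gd_comm] at this
      omega
    have w0n : gd (w 0) (w n) = n := by
      have h1 := far0 _ cw0
      have h2 := wpath 0 n (by omega)
      rw [zero_add] at h2
      omega
    have tri' : MetricTriangle α (w 0) (w n) := by
      refine ⟨fun q h1 h2 => h.fst q (cw0.symm.trans h1) (cwn.symm.trans h2), fun q h1 h2 => ?_,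
        fun q h1 h2 => ?_⟩
      · have := far0 q (cw0.symm.trans h1.symm).symm
        unfold Btw at h2
        exact (eq_of_gd_eq_zero (by omega)).symm
      · have := farn q (cwn.symm.trans h1.symm).symm
        unfold Btw at h2
        rw [gd_comm (w n) (w 0)] at h2
        exact (eq_of_gd_eq_zero (by omega)).symm
    obtain ⟨p, hp⟩ := ih α (w 0) (w n) tri' w0n
    have p0 : ∀ i, i ≤ n → p 0 i = w i := by
      intro i hi
      have h1 := wpath 0 i (by omega)
      have h2 := wpath i (n - i) (by omega)
      rw [zero_add] at h1
      rw [Nat.add_sub_cancel' hi] at h2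
      have h3 := gd_triangle (w 0) (w i) (w n)
      have h4 := hp.dist_snd 0 i (by omega)
      have h5 := hp.dist_thd 0 i (by omega)
      rw [gd_comm] at h5
      exact tri'.side_unique (by unfold Btw; omega) (by unfold Btw; omega) (by omega)
    have prow : ∀ h i j, h + i + j ≤ n → gd (p h i) (p h (i + j)) ≤ j := by
      intro h i j hj
      induction j with
      | zero => simp
      | succ j ihj =>
        have t := gd_triangle (p h i) (p h (i + j)) (p h (i + (j + 1)))
        have := hp.row h (i + j) (by omega)
        rw [← add_assoc] at *
        have := ihj (by omega)
        omega
    refine ⟨fun h i => Nat.casesOn h (v i) fun h => p h i, h, ?_, ?_, ?_, ?_, ?_, ?_⟩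
    · rintro (_ | h) i hi
      · exact vα i (by omega)
      · change gd α (p h i) + (h + 1) = n + 1
        have := hp.dist_fst h i (by omega)
        omega
    · rintro (_ | h) i hi
      · change gd β (v i) = 0 + i
        rw [(hv i (by omega)).1, zero_add]
      · change gd β (p h i) = h + 1 + i
        have h1 := hp.dist_snd h i (by omega)
        have h2 := gd_triangle β (w 0) (p h i)
        rw [gd_comm β (w 0)] at h2
        have h3 := prow h i (n - h - i) (by omega)
        rw [show i + (n - h - i) = n - h by omega] at h3
        have h4 := hp.dist_thd h (n - h) (by omega)
        have h5 := hp.dist_fst h (n - h) (by omega)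
        rw [gd_comm] at h5
        have h6 := cβ (p h (n - h)) (cwn.symm.trans (Btw.symm (by
          unfold Btw; rw [gd_comm (w n) α]; omega))).symm
        have h7 := gd_triangle β (p h i) (p h (n - h))
        omega
    · rintro (_ | h) i hi
      · change gd γ (v i) + i = n + 1
        have := vγ i (by omega)
        rw [gd_comm]; omega
      · change gd γ (p h i) + i = n + 1
        have h1 := hp.dist_thd h i (by omega)
        have h2 := gd_triangle γ (w n) (p h i)
        rw [gd_comm γ (w n)] at h2
        have h3 := prow h 0 i (by omega)
        rw [zero_add] at h3
        have h4 := hp.dist_snd h 0 (by omega)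
        have h5 := hp.dist_fst h 0 (by omega)
        rw [gd_comm] at h5
        have h6 := cγ (p h 0) (cw0.symm.trans (Btw.symm (by
          unfold Btw; rw [gd_comm (w 0) α]; omega))).symm
        have h7 := gd_triangle γ (p h i) (p h 0)
        rw [gd_comm (p h i)] at h7
        omega
    · rintro (_ | h) i hi
      · exact vadj i (by omega)
      · exact hp.row h i (by omega)
    · rintro (_ | h) i hi
      · change gd (v i) (p 0 i) = 1
        rw [p0 i (by omega), gd_comm]; exact (hw i (by omega)).2.1
      · exact hp.up h i (by omega)
    · rintro (_ | h) i hi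
      · change gd (v (i + 1)) (p 0 i) = 1
        rw [p0 i (by omega), gd_comm]; exact (hw i (by omega)).2.2
      · exact hp.diag h i (by omega)

namespace Flat

variable {n : ℕ} {α β γ : V} {p : ℕ → ℕ → V}

theorem rotate (hp : Flat n α β γ p) : Flat n β γ α (fun h i => p i (n - h - i)) where
  tri := hp.tri.rotate.rotate
  dist_fst h i hi := by
    have := hp.dist_snd i (n - h - i) (by omega)
    omega
  dist_snd h i hi := by
    have := hp.dist_thd i (n - h - i) (by omega)
    omega
  dist_thd h i hi := hp.dist_fst i (n - h - i) (by omega)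
  row h i hi := by
    have := hp.diag i (n - h - (i + 1)) (by omega)
    rwa [show n - h - (i + 1) + 1 = n - h - i by omega] at this
  up h i hi := by
    have := hp.row i (n - (h + 1) - i) (by omega)
    rw [show n - (h + 1) - i + 1 = n - h - i by omega] at this
    rwa [gd_comm]
  diag h i hi := by
    have := hp.up i (n - (h + 1) - i) (by omega)
    rw [gd_comm]
    rwa [show n - h - (i + 1) = n - (h + 1) - i by omega]

theorem base_right (hp : Flat n α β γ p) : p 0 n = γ :=
  (eq_of_gd_eq_zero (by have := hp.dist_thd 0 n (by omega); omega)).symm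

theorem gd_base (hp : Flat n α β γ p) : gd β γ = n := by
  have := hp.dist_snd 0 n (by omega)
  rw [hp.base_right] at this
  omega

theorem btw_base (hp : Flat n α β γ p) {i : ℕ} (hi : i ≤ n) : Btw β γ (p 0 i) := by
  have h1 := hp.dist_snd 0 i (by omega)
  have h2 := hp.dist_thd 0 i (by omega)
  have h3 := hp.gd_base
  rw [gd_comm] at h2
  unfold Btw
  omega

theorem injective (hp : Flat n α β γ p) {h i h' i' : ℕ} (hi : h + i ≤ n) (hi' : h' + i' ≤ n)
    (heq : p h i = p h' i') : h = h' ∧ i = i' := by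
  have h1 := hp.dist_fst h i hi
  have h2 := hp.dist_fst h' i' hi'
  have h3 := hp.dist_thd h i hi
  have h4 := hp.dist_thd h' i' hi'
  rw [heq] at h1 h3
  omega

end Flat

/-- An edge lying in at most two triangles. -/
def Thin (v w : V) : Prop := ∀ q r s, gd v q = 1 → gd w q = 1 → gd v r = 1 → gd w r = 1 →
  gd v s = 1 → gd w s = 1 → q = r ∨ q = s ∨ r = s

/-- Row `h` of a flat triangle contains a thin edge. -/
def ThinRow (n : ℕ) (p : ℕ → ℕ → V) (h : ℕ) : Prop :=
  ∃ i, h + i + 1 ≤ n ∧ Thin (p h i) (p h (i + 1))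

section Tower

variable {n : ℕ} {α α' β γ : V} {p p' : ℕ → ℕ → V}

theorem Flat.base_eq (hp : Flat n α β γ p) (hp' : Flat n α' β γ p') {i : ℕ} (hi : i ≤ n) :
    p 0 i = p' 0 i :=
  hp.tri.side_unique (hp.btw_base hi) (hp'.btw_base hi)
    (by rw [hp.dist_snd 0 i (by omega), hp'.dist_snd 0 i (by omega)])

theorem Flat.step_right (hp : Flat n α β γ p) (hp' : Flat n α' β γ p') {h i : ℕ}
    (hrow : ∀ i, h + i ≤ n → p h i = p' h i) (hi : h + i + 2 ≤ n)
    (heq : p (h + 1) i = p' (h + 1) i) : p (h + 1) (i + 1) = p' (h + 1) (i + 1) := by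
  by_contra hne
  have e1 := hrow (i + 1) (by omega)
  have e2 := hrow (i + 1 + 1) (by omega)
  refine no_square (v := p h (i + 1)) (p := p (h + 1) i) (q := p h (i + 1 + 1))
    (hp.diag h i (by omega)) (hp.row h (i + 1) (by omega)) (hp.up h (i + 1) (by omega)) ?_
    (hp.row (h + 1) i (by omega)) ?_ (hp.diag h (i + 1) (by omega)) ?_ (fun h' => ?_) hne
  · rw [e1]; exact hp'.up h (i + 1) (by omega)
  · rw [heq]; exact hp'.row (h + 1) i (by omega)
  · rw [e2]; exact hp'.diag h (i + 1) (by omega)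
  · have := hp.injective (by omega) (by omega) h'
    omega

theorem Flat.step_left (hp : Flat n α β γ p) (hp' : Flat n α' β γ p') {h i : ℕ}
    (hrow : ∀ i, h + i ≤ n → p h i = p' h i) (hi : h + i + 2 ≤ n)
    (heq : p (h + 1) (i + 1) = p' (h + 1) (i + 1)) : p (h + 1) i = p' (h + 1) i := by
  by_contra hne
  have e1 := hrow (i + 1) (by omega)
  have e2 := hrow i (by omega)
  refine no_square (v := p h (i + 1)) (p := p (h + 1) (i + 1)) (q := p h i)
    (hp.up h (i + 1) (by omega)) (by rw [gd_comm]; exact hp.row h i (by omega))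
    (hp.diag h i (by omega)) ?_ (by rw [gd_comm]; exact hp.row (h + 1) i (by omega)) ?_
    (hp.up h i (by omega)) ?_ (fun h' => ?_) hne
  · rw [e1]; exact hp'.diag h i (by omega)
  · rw [heq, gd_comm]; exact hp'.row (h + 1) i (by omega)
  · rw [e2]; exact hp'.up h i (by omega)
  · have := hp.injective (by omega) (by omega) h'
    omega

theorem Flat.row_eq (hp : Flat n α β γ p) (hp' : Flat n α' β γ p') {h i : ℕ}
    (hrow : ∀ i, h + i ≤ n → p h i = p' h i) (hi : h + 1 + i ≤ n)
    (heq : p (h + 1) i = p' (h + 1) i) (j : ℕ) (hj : h + 1 + j ≤ n) :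
    p (h + 1) j = p' (h + 1) j := by
  have right : ∀ k, h + 1 + (i + k) ≤ n → p (h + 1) (i + k) = p' (h + 1) (i + k) := by
    intro k
    induction k with
    | zero => intro _; exact heq
    | succ k ih =>
      intro hk
      rw [← add_assoc] at hk ⊢
      exact hp.step_right hp' hrow (by omega) (ih (by omega))
  have left : ∀ k j, j + k = i → p (h + 1) j = p' (h + 1) j := by
    intro k
    induction k with
    | zero => rintro j rfl; exact heq
    | succ k ih => intro j hk; exact hp.step_left hp' hrow (by omega) (ih (j + 1) (by omega))
  rcases le_total i j with hij | hij
  · have := right (j - i) (by omega)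
    rwa [Nat.add_sub_cancel' hij] at this
  · exact left (i - j) j (by omega)

/-- A flat triangle is determined by its base and one further vertex, up to the first row
without thin edges. -/
theorem Flat.tower_unique (hp : Flat n α β γ p) (hp' : Flat n α' β γ p') {H : ℕ}
    (hthin : ∀ h, 1 ≤ h → h < H → ThinRow n p h) (hH : 1 ≤ H → p 1 0 = p' 1 0) :
    ∀ h ≤ H, ∀ i, h + i ≤ n → p h i = p' h i := by
  intro h
  induction h using Nat.strong_induction_on with
  | _ h ih =>
    match h with
    | 0 => exact fun _ i hi => hp.base_eq hp' (by omega)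
    | 1 =>
      intro h1 i hi
      exact hp.row_eq hp' (h := 0) (fun i hi => hp.base_eq hp' (by omega)) (i := 0) (by omega)
        (hH h1) i hi
    | h + 2 =>
      intro hh j hj
      obtain ⟨i, hi, ht⟩ := hthin (h + 1) (by omega) (by omega)
      have r1 := ih (h + 1) (by omega) (by omega)
      have hrow := ih h (by omega) (by omega)
      refine hp.row_eq hp' (h := h + 1) (i := i) r1 (by omega) ?_ j hj
      have a1 := hp.up (h + 1) i (by omega)
      have a2 := hp.diag (h + 1) i (by omega)
      have a3 := hp.diag h i (by omega)
      have a4 := hp.up h (i + 1) (by omega)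
      have b1 := hp'.up (h + 1) i (by omega)
      have b2 := hp'.diag (h + 1) i (by omega)
      rw [← r1 _ (by omega)] at b1 b2
      rw [gd_comm] at a3 a4
      rcases ht _ _ _ a3 a4 a1 a2 b1 b2 with h' | h' | h'
      · have := hp.injective (by omega) (by omega) h'
        omega
      · rw [hrow (i + 1) (by omega)] at h'
        have := hp'.injective (by omega) (by omega) h'
        omega
      · exact h'

end Tower

/-! ### Cardinality bounds -/

/-- A set contained in a finite set with at most `N` elements. -/
def Small {X : Type*} (S : Set X) (N : ℕ) : Prop := ∃ F : Finset X, F.card ≤ N ∧ S ⊆ F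

theorem Small.mono {X : Type*} {S T : Set X} {N M : ℕ} (h : Small T N) (hS : S ⊆ T)
    (hN : N ≤ M) : Small S M :=
  let ⟨F, h1, h2⟩ := h
  ⟨F, h1.trans hN, hS.trans h2⟩

theorem small_of_rel {X ι : Type*} {S : Set X} {N : ℕ} (F : Finset ι) (hF : F.card ≤ N)
    (R : ι → X → Prop) (h1 : ∀ m ∈ S, ∃ i ∈ F, R i m)
    (h2 : ∀ i, ∀ m ∈ S, ∀ m' ∈ S, R i m → R i m' → m = m') : Small S N := by
  classical
  refine ⟨F.biUnion fun i => if h : ∃ m ∈ S, R i m then {h.choose} else ∅, ?_, ?_⟩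
  · have := Finset.card_biUnion_le_card_mul F
      (fun i => if h : ∃ m ∈ S, R i m then {h.choose} else ∅) 1 fun i _ => by
        split_ifs <;> simp
    omega
  · intro m hm
    obtain ⟨i, hi, hR⟩ := h1 m hm
    simp only [Finset.coe_biUnion, Set.mem_iUnion]
    refine ⟨i, hi, ?_⟩
    have hex : ∃ m ∈ S, R i m := ⟨m, hm, hR⟩
    rw [dif_pos hex]
    simpa using h2 i m hm _ hex.choose_spec.1 hR hex.choose_spec.2

theorem Small.bind {X Y : Type*} {S : Set X} {T : X → Set Y} {N M : ℕ} (hS : Small S N)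
    (hT : ∀ x ∈ S, Small (T x) M) : Small {y | ∃ x ∈ S, y ∈ T x} (N * M) := by
  classical
  obtain ⟨F, h1, h2⟩ := hS
  choose! G h3 h4 using hT
  refine ⟨(F.filter (· ∈ S)).biUnion G, ?_, ?_⟩
  · refine (Finset.card_biUnion_le_card_mul _ _ M fun x hx => h3 x (Finset.mem_filter.mp hx).2).trans
      (Nat.mul_le_mul_right _ ((Finset.card_filter_le _ _).trans h1))
  · rintro y ⟨x, hx, hy⟩
    simp only [Finset.coe_biUnion, Set.mem_iUnion]
    exact ⟨x, by simpa using ⟨h2 hx, hx⟩, h4 x hx hy⟩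

theorem small_ball_one (v : V) : Small {w | gd v w ≤ 1} 14 := by
  obtain ⟨x, rfl⟩ := vert_surjective v
  refine small_of_rel (Finset.univ : Finset Simple) (by simp)
    (fun s w => w = vert (x * val s)) ?_ ?_
  · intro w hw
    obtain ⟨y, rfl, h1, h2⟩ := exists_lift hw
    have h1 := (mul_le_mul_left_iff x⁻¹).mpr h1
    have h2 := (mul_le_mul_left_iff x⁻¹).mpr h2
    rw [inv_mul_cancel] at h1
    rw [mul_sh, inv_mul_cancel, sh, one_mul, Nat.cast_one, zpow_one] at h2
    obtain ⟨s, hs⟩ := exists_val_eq h1 h2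
    exact ⟨s, Finset.mem_univ _, by rw [hs, mul_inv_cancel_left]⟩
  · rintro s _ _ _ _ rfl rfl
    rfl

theorem small_ball (v : V) (k : ℕ) : Small {w | gd v w ≤ k} (14 ^ k) := by
  induction k with
  | zero =>
    refine ⟨{v}, by simp, fun w hw => ?_⟩
    simpa using (eq_of_gd_eq_zero (Nat.le_zero.mp hw)).symm
  | succ k ih =>
    refine (Small.bind (T := fun w => {q | gd w q ≤ 1}) ih fun w _ => small_ball_one w).mono ?_
      (by rw [pow_succ])
    intro w hw
    by_cases h : gd v w ≤ k
    · exact ⟨w, h, by simp⟩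
    · have hw : gd v w ≤ k + 1 := hw
      obtain ⟨q, h1, h2⟩ := exists_pred (k := k) (by omega : gd v w = k + 1)
      exact ⟨q, h1.le, h2.le⟩

/-- The part of an interval within a bounded distance of an end point. -/
theorem small_interval (u v : V) (R : ℕ) :
    Small {q | Btw u v q ∧ gd u q ≤ R} ((R + 1) * (3 * R + 1)) := by
  obtain ⟨x, rfl⟩ := vert_surjective u
  refine small_of_rel (Finset.range (R + 1) ×ˢ Finset.range (3 * R + 1))
    (by simp) (fun i q => ∃ y, vert y = q ∧ Lift x i.1 y ∧ deg y = deg x + i.2) ?_ ?_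
  · rintro q ⟨-, hq⟩
    obtain ⟨y, rfl, hy⟩ := exists_isLift (rfl : gd (vert x) q = _)
    have h1 := deg_mono hy.1
    have h2 := deg_mono hy.2.1
    rw [deg_sh] at h2
    refine ⟨(gd (vert x) (vert y), (deg y - deg x).toNat), ?_, y, rfl, hy, ?_⟩
    · simp only [Finset.mem_product, Finset.mem_range]
      omega
    · simp only
      omega
  · rintro ⟨k, d⟩ _ ⟨hm, -⟩ _ ⟨hm', -⟩ ⟨y, rfl, hy, hd⟩ ⟨y', rfl, hy', hd'⟩
    have g1 := hy.2.2
    have g2 := hy'.2.2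
    simp only at g1 g2 hd hd'
    unfold Btw at hm hm'
    obtain ⟨z, rfl, hz⟩ := exists_isLift (rfl : gd (vert x) v = _)
    obtain ⟨m, hk⟩ : ∃ m, gd (vert x) (vert z) = k + m := ⟨gd (vert y) (vert z), by omega⟩
    rw [hk] at hz
    rcases interval_comparable hz hy hy' (by omega) (by omega) with h | h
    · rw [eq_of_le_of_deg h (by omega)]
    · rw [eq_of_le_of_deg h (by omega)]

/-- The vertices of flat triangles with base `β, γ` which lie below the first row without
thin edges. -/
def Reach (N : ℕ) (β γ : V) : Set V :=
  {m | ∃ n ≤ N, ∃ α p h i, Flat n α β γ p ∧ h + i ≤ n ∧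
    (∀ k, 1 ≤ k → k < h → ThinRow n p k) ∧ m = p h i}

theorem small_reach (N : ℕ) (β γ : V) : Small (Reach N β γ) (14 * ((N + 1) * (N + 1))) := by
  obtain ⟨F, hF, hb⟩ := small_ball_one β
  refine small_of_rel (F ×ˢ (Finset.range (N + 1) ×ˢ Finset.range (N + 1)))
    (by simpa using hF)
    (fun j m => ∃ n ≤ N, ∃ α p, Flat n α β γ p ∧ j.2.1 + j.2.2 ≤ n ∧
      (∀ k, 1 ≤ k → k < j.2.1 → ThinRow n p k) ∧ m = p j.2.1 j.2.2 ∧ (1 ≤ j.2.1 → j.1 = p 1 0))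
    ?_ ?_
  · rintro m ⟨n, hn, α, p, h, i, h1, h2, h3, rfl⟩
    by_cases hh : 1 ≤ h
    · refine ⟨(p 1 0, h, i), ?_, n, hn, α, p, h1, h2, h3, rfl, fun _ => rfl⟩
      have h4 : p 1 0 ∈ F := hb (show gd β (p 1 0) ≤ 1 from
        (h1.dist_snd 1 0 (by omega)).le)
      simp only [Finset.mem_product, Finset.mem_range]
      exact ⟨h4, by omega, by omega⟩
    · refine ⟨(β, h, i), ?_, n, hn, α, p, h1, h2, h3, rfl, fun h => absurd h hh⟩
      have h4 : β ∈ F := hb (show gd β β ≤ 1 by simp)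
      simp only [Finset.mem_product, Finset.mem_range]
      exact ⟨h4, by omega, by omega⟩
  · rintro ⟨w, h, i⟩ _ - _ - ⟨n, hn, α, p, h1, h2, h3, rfl, h4⟩
      ⟨n', hn', α', p', h1', h2', h3', rfl, h4'⟩
    have e1 := h1.gd_base
    have e2 := h1'.gd_base
    obtain rfl : n = n' := by omega
    exact h1.tower_unique h1' h3 (fun hh => (h4 hh).symm.trans (h4' hh)) h le_rfl i h2

/-! ### Tilings of a flat triangle by factorisations of `δ` into atoms -/

/-- The atoms other than the two long ones. -/
def shortAtom : ℕ → Bool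
  | 4 => false
  | 5 => false
  | _ => true

/-- For each atom `u`, the pairs `y, z` of atoms with `u * y * z = δ`. -/
def tailTable : List (List (ℕ × ℕ)) :=
  [[],
   [(2, 3), (3, 5), (5, 2)],
   [(3, 6), (4, 3), (6, 4)],
   [(1, 5), (5, 6), (6, 1)],
   [(1, 3), (3, 1)],
   [(2, 6), (6, 2)],
   [(1, 2), (2, 4), (4, 1)]]

/-- For atoms `y` and `z`, the atom `u` with `y * u * z = δ`, and `0` if there is none. -/
def midTable : List (List ℕ) :=
  [[0, 0, 0, 0, 0, 0, 0],
   [0, 0, 5, 2, 0, 3, 0],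
   [0, 0, 0, 4, 6, 0, 3],
   [0, 6, 0, 0, 0, 1, 5],
   [0, 3, 0, 1, 0, 0, 0],
   [0, 0, 6, 0, 0, 0, 2],
   [0, 4, 1, 0, 2, 0, 0]]

def tails (u : ℕ) : List (ℕ × ℕ) := tailTable.getD u []

def mid (y z : ℕ) : ℕ := (midTable.getD y []).getD z 0

/-- All completions of the tiling of one line, above the line `w` and starting with the tile
`u, y, z`; with `top` set the last tile lies on the left side of the triangle. -/
def grow (top : Bool) : List (ℕ × ℕ) → ℕ → ℕ → ℕ → List (List (ℕ × ℕ))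
  | [], _, y, z => bif top && !shortAtom z then [] else [[(y, z)]]
  | v :: w, u, y, z => bif Nat.beq u v.1 || Nat.beq (mid v.1 z) v.2 then [] else
      (tails (mid v.1 z)).flatMap fun t => bif Nat.beq t.1 z then [] else
        (grow top w (mid v.1 z) t.1 t.2).map ((y, z) :: ·)

/-- The possible lines above `w`, truncated to their first five tiles. -/
def nextLines (top : Bool) (w : List (ℕ × ℕ)) : List (List (ℕ × ℕ)) :=
  [1, 2, 3, 6].flatMap fun u => (tails u).flatMap fun t => (grow top w u t.1 t.2).map (List.take 5)

/-- The possible `j`-th lines near the corner, for `j ≤ 5`. -/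
def cornerLines : ℕ → List (List (ℕ × ℕ))
  | 0 => [[]]
  | j + 1 => (cornerLines j).flatMap (nextLines true)

/-- The line whose letters are the ten decimal digits of a number. -/
def decode (k : ℕ) : List (ℕ × ℕ) :=
  [(k / 1000000000, k / 100000000 % 10), (k / 10000000 % 10, k / 1000000 % 10),
   (k / 100000 % 10, k / 10000 % 10), (k / 1000 % 10, k / 100 % 10), (k / 10 % 10, k % 10)]

def encode : List (ℕ × ℕ) → ℕ
  | [v₁, v₂, v₃, v₄, v₅] => v₁.1 * 1000000000 + v₁.2 * 100000000 + v₂.1 * 10000000 +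
      v₂.2 * 1000000 + v₃.1 * 100000 + v₃.2 * 10000 + v₄.1 * 1000 + v₄.2 * 100 + v₅.1 * 10 + v₅.2
  | _ => 0

def sameLine : List (ℕ × ℕ) → List (ℕ × ℕ) → Bool
  | [], [] => true
  | v :: w, v' :: w' => Nat.beq v.1 v'.1 && (Nat.beq v.2 v'.2 && sameLine w w')
  | _, _ => false

theorem eq_of_sameLine : ∀ {w w' : List (ℕ × ℕ)}, sameLine w w' = true → w = w'
  | [], [], _ => rfl
  | [], _ :: _, h => by simp [sameLine] at h
  | _ :: _, [], h => by simp [sameLine] at h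
  | v :: w, v' :: w', h => by
    simp only [sameLine, Bool.and_eq_true, Nat.beq_eq] at h
    rw [Prod.ext h.1 h.2.1, eq_of_sameLine h.2.2]

/-- The possible lines, truncated to their first five tiles. -/
def lineTable : List ℕ :=
  [1212412412, 1212625212, 1212625241, 1241241212, 1241241241, 1241241262, 1241242412,
   1241412412, 1241561515, 1241561561, 1241563626, 1241563643, 1241564323, 1241564343,
   1241564352, 1241564364, 1241565615, 1241613141, 1241615615, 1262521212, 1262521241,
   1262521262, 1262524156, 1262524161, 1262525212, 1262525241, 1262625212, 1262625241,
   1515613141, 1515615615, 1561313141, 1561314141, 1561314156, 1561314161, 1561561515,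
   1561561561, 1561563626, 1561563643, 1561564323, 1561564343, 1561564352, 1561564364,
   1561565615, 1561613141, 1561615615, 2313134323, 2313134352, 2313432313, 2313432323,
   2313432352, 2313434323, 2313434352, 2313435212, 2313435241, 2323134323, 2323134352,
   2323523523, 2352124124, 2352126252, 2352352313, 2352352323, 2352352352, 2352353523,
   2352412412, 2352412424, 2352414124, 2352415615, 2352415636, 2352415643, 2352415656,
   2352416131, 2352416156, 2352523523, 2412124124, 2412126252, 2412412412, 2412412424,
   2412414124, 2412415615, 2412415636, 2412415643, 2412415656, 2412416131, 2412416156,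
   2412625212, 2412625241, 2412625252, 2412626252, 2424124124, 2424126252, 3523131343,
   3523134323, 3523134343, 3523134352, 3523231343, 3523235235, 3523521241, 3523521262,
   3523523523, 3523523535, 3523524124, 3523524141, 3523524156, 3523524161, 3523525235,
   3535231343, 3535235235, 3626265636, 3626265643, 3626563626, 3626563636, 3626563643,
   3626564323, 3626564352, 3626565636, 3626565643, 3636265636, 3636265643, 3636436436,
   3643231343, 3643235235, 3643436436, 3643521241, 3643521262, 3643523523, 3643523535,
   3643524124, 3643524141, 3643524156, 3643524161, 3643525235, 3643643626, 3643643636,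
   3643643643, 3643646436, 4124121241, 4124121262, 4124124124, 4124124141, 4124124156,
   4124124161, 4124126262, 4124241241, 4124241262, 4141241241, 4141241262, 4156151561,
   4156156131, 4156156156, 4156156161, 4156362656, 4156364364, 4156432313, 4156432352,
   4156434364, 4156435212, 4156435235, 4156435241, 4156435252, 4156436436, 4156436464,
   4156561561, 4161314156, 4161314161, 4161561561, 4323134323, 4323134352, 4323523523,
   4343643626, 4343643643, 4352124124, 4352126252, 4352352313, 4352352323, 4352352352,
   4352353523, 4352412412, 4352412424, 4352414124, 4352415615, 4352415636, 4352415643,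
   4352415656, 4352416131, 4352416156, 4352523523, 4364362626, 4364363626, 4364363643,
   4364364323, 4364364343, 4364364352, 4364364364, 4364643626, 4364643643, 5212412412,
   5212625212, 5212625241, 5235231313, 5235232313, 5235232352, 5235235212, 5235235235,
   5235235241, 5235235252, 5235352313, 5235352352, 5241241212, 5241241241, 5241241262,
   5241242412, 5241412412, 5241561515, 5241561561, 5241563626, 5241563643, 5241564323,
   5241564343, 5241564352, 5241564364, 5241565615, 5241613141, 5241615615, 5252352313,
   5252352352, 5615156131, 5615156156, 5615613131, 5615615615, 5615615636, 5615615643,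
   5615615656, 5615616131, 5615616156, 5636265636, 5636265643, 5636436436, 5643231343,
   5643235235, 5643436436, 5643521241, 5643521262, 5643523523, 5643523535, 5643524124,
   5643524141, 5643524156, 5643524161, 5643525235, 5643643626, 5643643636, 5643643643,
   5643646436, 5656156131, 5656156156, 6131314156, 6131314161, 6131414156, 6131414161,
   6131415636, 6131415643, 6131416131, 6131416156, 6131416161, 6156151561, 6156156131,
   6156156156, 6156156161, 6156362656, 6156364364, 6156432313, 6156432352, 6156434364,
   6156435212, 6156435235, 6156435241, 6156435252, 6156436436, 6156436464, 6156561561,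
   6161314156, 6161314161, 6161561561, 6436262656, 6436265636, 6436265643, 6436265656,
   6436362656, 6436364364, 6436432313, 6436432352, 6436434364, 6436435212, 6436435235,
   6436435241, 6436435252, 6436436436, 6436436464, 6464362656, 6464364364]

def inTable (w : List (ℕ × ℕ)) : Bool :=
  sameLine (decode (encode w)) w && lineTable.any (Nat.beq (encode w))

theorem inTable_cornerLines : ((cornerLines 5).all inTable) = true := by decide +kernel

theorem inTable_nextLines :
    (lineTable.all fun k => (nextLines false (decode k)).all inTable) = true := by decide +kernel

theorem lineTable_long :
    (lineTable.all fun k => (decode k).any fun v => !shortAtom v.1) = true := by decide +kernel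

/-- The letters of a tiling of a triangle with side `n`. -/
structure Tiling (n : ℕ) (U Y Z : ℕ → ℕ → ℕ) : Prop where
  up : ∀ h i, h + i + 1 ≤ n → (Y h i, Z h i) ∈ tails (U h i)
  down : ∀ h i, h + i + 2 ≤ n → mid (Y h i) (Z h (i + 1)) = U (h + 1) i
  fold_fst : ∀ h i, h + i + 2 ≤ n → U h (i + 1) ≠ Y h i
  fold_snd : ∀ h i, h + i + 2 ≤ n → Y (h + 1) i ≠ Z h (i + 1)
  fold_thd : ∀ h i, h + i + 2 ≤ n → U (h + 1) i ≠ Z h i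

/-- The letters of `m` consecutive tiles on a line. -/
def segment (Y Z : ℕ → ℕ → ℕ) : ℕ → ℕ → ℕ → List (ℕ × ℕ)
  | _, _, 0 => []
  | h, i, m + 1 => (Y h i, Z h i) :: segment Y Z (h + 1) (i - 1) m

theorem natBeq_eq_false {m n : ℕ} (h : m ≠ n) : Nat.beq m n = false := by
  rwa [← Bool.not_eq_true, Nat.beq_eq]

namespace Tiling

variable {n : ℕ} {U Y Z : ℕ → ℕ → ℕ}

theorem take_segment (m k h i : ℕ) :
    (segment Y Z h i m).take k = segment Y Z h i (min k m) := by
  induction m generalizing k h i with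
  | zero => simp [segment]
  | succ m ih =>
    cases k with
    | zero => simp [segment]
    | succ k => simp [segment, ih]

theorem segment_mem_grow (ht : Tiling n U Y Z) (top : Bool) (m : ℕ) : ∀ h i, m ≤ i →
    h + i + 1 ≤ n → (top = true → shortAtom (Z (h + m) (i - m)) = true) →
    segment Y Z h i (m + 1) ∈ grow top (segment Y Z h (i - 1) m) (U h i) (Y h i) (Z h i) := by
  induction m with
  | zero =>
    intro h i _ _ htop
    cases top with
    | false => simp [segment, grow]
    | true =>
      have : shortAtom (Z h i) = true := htop rfl
      simp [segment, grow, this]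
  | succ m ih =>
    intro h i hm hi htop
    obtain ⟨i, rfl⟩ : ∃ k, i = k + 1 := ⟨i - 1, by omega⟩
    have h1 : Nat.beq (U h (i + 1)) (Y h i) = false :=
      natBeq_eq_false (ht.fold_fst h i (by omega))
    have h2 : Nat.beq (U (h + 1) i) (Z h i) = false :=
      natBeq_eq_false (ht.fold_thd h i (by omega))
    have h3 : Nat.beq (Y (h + 1) i) (Z h (i + 1)) = false :=
      natBeq_eq_false (ht.fold_snd h i (by omega))
    rw [segment, add_tsub_cancel_right, segment, grow]
    simp only [ht.down h i (by omega), h1, h2, Bool.or_false, cond_false]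
    rw [List.mem_flatMap]
    refine ⟨_, ht.up (h + 1) i (by omega), ?_⟩
    simp only [h3, cond_false, List.mem_map]
    refine ⟨_, ih (h + 1) i (by omega) (by omega) fun e => ?_, rfl⟩
    have := htop e
    rwa [show h + (m + 1) = h + 1 + m by omega, show i + 1 - (m + 1) = i - m by omega] at this

theorem segment_mem_nextLines (ht : Tiling n U Y Z) (top : Bool) {m i : ℕ} (hm : m ≤ i)
    (hi : i + 1 ≤ n) (hU : U 0 i ∈ [1, 2, 3, 6])
    (htop : top = true → shortAtom (Z m (i - m)) = true) :
    segment Y Z 0 i (min 5 (m + 1)) ∈ nextLines top (segment Y Z 0 (i - 1) m) := by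
  rw [nextLines, List.mem_flatMap]
  refine ⟨_, hU, ?_⟩
  rw [List.mem_flatMap]
  refine ⟨_, ht.up 0 i (by omega), ?_⟩
  rw [List.mem_map]
  exact ⟨_, ht.segment_mem_grow top m 0 i hm (by omega) (by simpa using htop),
    take_segment _ _ _ _⟩

theorem exists_long (ht : Tiling n U Y Z) (hn : 5 ≤ n) (hU : ∀ i, i + 1 ≤ n → U 0 i ∈ [1, 2, 3, 6])
    (hZ : ∀ h, h + 1 ≤ n → shortAtom (Z h 0) = true) :
    ∃ h i, h + i + 1 = n ∧ shortAtom (Y h i) = false := by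
  have corner : ∀ j ≤ 5, segment Y Z 0 (j - 1) j ∈ cornerLines j := by
    intro j
    induction j with
    | zero => intro _; simp [segment, cornerLines]
    | succ j ih =>
      intro hj
      rw [cornerLines, List.mem_flatMap]
      refine ⟨_, ih (by omega), ?_⟩
      have := ht.segment_mem_nextLines true le_rfl (by omega) (hU j (by omega))
        (fun _ => by rw [Nat.sub_self]; exact hZ j (by omega))
      rwa [min_eq_right hj] at this
  have key : ∀ k, k + 5 ≤ n → inTable (segment Y Z 0 (k + 4) 5) = true := by
    intro k
    induction k with
    | zero => exact fun _ => List.all_eq_true.1 inTable_cornerLines _ (corner 5 le_rfl)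
    | succ k ih =>
      intro hk
      have h1 := ih (by omega)
      rw [inTable, Bool.and_eq_true, List.any_eq_true] at h1
      obtain ⟨h2, l, hl, h3⟩ := h1
      rw [Nat.beq_eq] at h3
      subst h3
      refine List.all_eq_true.1 (List.all_eq_true.1 inTable_nextLines _ hl) _ ?_
      rw [eq_of_sameLine h2]
      exact ht.segment_mem_nextLines false (m := 5) (i := k + 5) (by omega) (by omega)
        (hU _ (by omega)) (by simp)
  have h1 := key (n - 5) (by omega)
  rw [inTable, Bool.and_eq_true, List.any_eq_true] at h1
  obtain ⟨h2, l, hl, h3⟩ := h1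
  rw [Nat.beq_eq] at h3
  subst h3
  have h4 := List.all_eq_true.1 lineTable_long _ hl
  rw [eq_of_sameLine h2, show n - 5 + 4 = n - 1 by omega] at h4
  have h5 : ∀ m h i, m ≤ i + 1 → (segment Y Z h i m).any (fun v => !shortAtom v.1) = true →
      ∃ h' i', h' + i' = h + i ∧ shortAtom (Y h' i') = false := by
    intro m
    induction m with
    | zero => intro h i _ h'; simp [segment] at h'
    | succ m ih =>
      intro h i hm h'
      rw [segment, List.any_cons, Bool.or_eq_true] at h'
      rcases h' with h' | h'
      · exact ⟨h, i, rfl, by simpa using h'⟩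
      · obtain rfl | hi := Nat.eq_zero_or_pos m
        · simp [segment] at h'
        obtain ⟨a, b, hab, hs⟩ := ih _ _ (by omega) h'
        exact ⟨a, b, by omega, hs⟩
  obtain ⟨h, i, hi, hs⟩ := h5 5 0 (n - 1) (by omega) h4
  exact ⟨h, i, by omega, hs⟩

end Tiling

/-! ### Letters of a triangulated patch -/

theorem val_injective {s t : Simple} (h : val s = val t) : s = t := by
  have key : ∀ s : Simple, ∃ L, IsNormal L ∧ wordVal L = val s ∧ L = if s = 0 then [] else [s] := by
    intro s
    by_cases hs : s = 0
    · exact ⟨[], isNormal_nil, by rw [hs]; rfl, by simp [hs]⟩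
    · exact ⟨[s], by simp [IsNormal, hs], by simp, by simp [hs]⟩
  obtain ⟨L, hL, eL, hL'⟩ := key s
  obtain ⟨M, hM, eM, hM'⟩ := key t
  have := wordVal_injective hL hM (by rw [eL, eM, h])
  rw [hL', hM'] at this
  split_ifs at this <;> simp_all

theorem rest_zero_right : ∀ s, rest s 0 = 0 := by decide

theorem rest_eq_zero_of_mul {s t u : Simple} (h : val s * val t = val u) :
    rest s t = 0 ∧ lead s t = u := by
  by_cases hr : rest s t = 0
  · exact ⟨hr, val_injective (by rw [← h, val_mul s t hr])⟩
  · exfalso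
    have hl : lead s t ≠ 0 := lead_ne_zero s t fun ht => hr (by rw [ht]; exact rest_zero_right s)
    have hN : IsNormal [lead s t, rest s t] := by
      have := lead_rest_idem s t
      simp [IsNormal, hr, hl, this]
    rw [← val_lead_mul_val_rest] at h
    by_cases hu : u = 0
    · have := wordVal_injective hN isNormal_nil (by
        simp only [wordVal_cons, wordVal_nil, mul_one]
        rw [h, hu]; rfl)
      simp at this
    · have := wordVal_injective hN (M := [u]) (by simp [IsNormal, hu]) (by simpa using h)
      simp at this

def IsAtom (s : Simple) : Prop := rank s = 1

instance (s : Simple) : Decidable (IsAtom s) := inferInstanceAs (Decidable (rank s = 1))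

theorem exists_of_mul_eq_delta {u y z : Simple} (h : val u * val y * val z = δ) :
    rest u y = 0 ∧ rest (lead u y) z = 0 ∧ lead (lead u y) z = 13 := by
  have h1 : val u * val y ≤ δ := by
    obtain ⟨L, hL⟩ := one_le_val z
    refine ⟨L, ?_⟩
    rw [← h, hL, one_mul]
  have h2 : 1 ≤ val u * val y := ⟨[u, y], by simp⟩
  obtain ⟨s, hs⟩ := exists_val_eq h2 h1
  obtain ⟨h3, h4⟩ := rest_eq_zero_of_mul hs.symm
  have := rest_eq_zero_of_mul (s := s) (t := z) (u := 13) (by rw [hs, h, val_top])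
  rw [h4]
  exact ⟨h3, this⟩

theorem tails_of_factorization : ∀ u y z : Simple, IsAtom u → IsAtom y → IsAtom z → rest u y = 0 →
    rest (lead u y) z = 0 → lead (lead u y) z = 13 →
    (y.val, z.val) ∈ tails u.val ∧ mid u.val z.val = y.val := by decide +kernel

theorem factor_tails {u y z : Simple} (hu : IsAtom u) (hy : IsAtom y) (hz : IsAtom z)
    (h : val u * val y * val z = δ) :
    (y.val, z.val) ∈ tails u.val ∧ mid u.val z.val = y.val := by
  obtain ⟨h1, h2, h3⟩ := exists_of_mul_eq_delta h
  exact tails_of_factorization u y z hu hy hz h1 h2 h3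

theorem exists_mul_val {x y : B4} (h1 : x ≤ y) (h2 : y ≤ sh 1 x) : ∃ s, y = x * val s := by
  obtain ⟨s, hs⟩ := exists_val_eq (x := x⁻¹ * y)
    (by rwa [← mul_le_mul_left_iff x, mul_one, mul_inv_cancel_left])
    (by rw [← mul_le_mul_left_iff x, mul_inv_cancel_left]; simpa [sh] using h2)
  exact ⟨s, by rw [hs, mul_inv_cancel_left]⟩

theorem between_of_adjacent {x y : B4} (h : gd (vert x) (vert y) = 1) (h1 : 0 < deg y - deg x)
    (h2 : deg y - deg x < 3) : x ≤ y ∧ y ≤ sh 1 x := by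
  obtain ⟨y', hy, hx, hxy⟩ := exists_lift h.le
  obtain ⟨k, rfl⟩ := vert_eq_iff.1 hy
  have hn : vert x ≠ vert (sh k y') := fun e => by rw [e, gd_self] at h; omega
  have d1 := deg_lt hx (fun e => hn (by rw [e, vert_sh]))
  have d2 := deg_lt hxy (fun e => hn (by rw [vert_sh, e, vert_sh]))
  simp only [deg_sh, Nat.cast_one] at *
  obtain rfl : k = 0 := by omega
  simpa using ⟨hx, hxy⟩

/-- The degree of a vertex, modulo the degree of `δ`. -/
noncomputable def color (v : V) : ZMod 3 := (deg (vert_surjective v).choose : ZMod 3)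

theorem color_vert (x : B4) : color (vert x) = deg x := by
  obtain ⟨k, hk⟩ := vert_eq_iff.1 (vert_surjective (vert x)).choose_spec
  rw [color]
  conv_rhs => rw [hk]
  rw [deg_sh]
  push_cast
  rw [show (3 : ZMod 3) = 0 from rfl, zero_mul, add_zero]

theorem exists_deg_eq {v : V} {d : ℤ} (h : color v = d) : ∃ x, vert x = v ∧ deg x = d := by
  obtain ⟨x, rfl⟩ := vert_surjective v
  rw [color_vert, ZMod.intCast_eq_intCast_iff_dvd_sub] at h
  obtain ⟨k, hk⟩ := h
  exact ⟨sh k x, vert_sh _ _, by rw [deg_sh]; push_cast at hk; omega⟩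

theorem color_ne {v w : V} (h : gd v w = 1) : color v ≠ color w := by
  obtain ⟨x, rfl⟩ := vert_surjective v
  obtain ⟨y, rfl, hx, hxy⟩ := exists_lift h.le
  have hn : vert x ≠ vert y := fun e => by rw [e, gd_self] at h; omega
  have d1 := deg_lt hx (fun e => hn (by rw [e]))
  have d2 := deg_lt hxy (fun e => hn (by rw [e, vert_sh]))
  rw [deg_sh] at d2
  rw [color_vert, color_vert]
  intro e
  rw [ZMod.intCast_eq_intCast_iff_dvd_sub] at e
  obtain ⟨k, hk⟩ := e
  push_cast at *
  omega

/-- A nondegenerate triangulated triangle with side `n`. -/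
structure Patch (n : ℕ) (p : ℕ → ℕ → V) : Prop where
  row : ∀ h i, h + i + 1 ≤ n → gd (p h i) (p h (i + 1)) = 1
  up : ∀ h i, h + i + 1 ≤ n → gd (p h i) (p (h + 1) i) = 1
  diag : ∀ h i, h + i + 1 ≤ n → gd (p h (i + 1)) (p (h + 1) i) = 1
  inj : ∀ h i h' i', h + i ≤ n → h' + i' ≤ n → p h i = p h' i' → h = h' ∧ i = i'

theorem color_sum : ∀ x y z : ZMod 3, x ≠ y → y ≠ z → x ≠ z → z = -x - y := by
  decide

namespace Patch

variable {n : ℕ} {p : ℕ → ℕ → V}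

theorem color_eq (hp : Patch n p) : ∀ h i, h + i ≤ n →
    color (p h i) = color (p 0 0) + (color (p 0 1) - color (p 0 0)) * (i - h) := by
  have up : ∀ h i, h + i + 1 ≤ n →
      color (p (h + 1) i) = -color (p h i) - color (p h (i + 1)) := fun h i hi =>
    color_sum _ _ _ (color_ne (hp.row h i hi)) (color_ne (hp.diag h i hi))
      (color_ne (hp.up h i hi))
  have dn : ∀ h i, h + i + 2 ≤ n → color (p (h + 1) (i + 1)) = color (p h i) := fun h i hi => by
    rw [color_sum _ _ _ (color_ne (hp.diag h i (by omega)))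
      (color_ne (hp.row (h + 1) i (by omega))) (color_ne (hp.up h (i + 1) (by omega))),
      up h i (by omega)]
    ring
  have three : (3 : ZMod 3) = 0 := rfl
  intro h
  induction h with
  | zero =>
    intro i
    induction i using Nat.strong_induction_on with
    | _ i ih =>
      intro hi
      match i with
      | 0 => simp
      | 1 => simp
      | i + 2 =>
        have h1 := dn 0 i (by omega)
        have h2 := up 0 (i + 1) (by omega)
        rw [h1, ih i (by omega) (by omega), ih (i + 1) (by omega) (by omega)] at h2
        push_cast at h2 ⊢
        linear_combination h2 - (color (p 0 0) + (color (p 0 1) - color (p 0 0)) * (i + 1)) * three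
  | succ h ih =>
    intro i hi
    rw [up h i (by omega), ih i (by omega), ih (i + 1) (by omega)]
    push_cast
    linear_combination (- color (p 0 0) - (color (p 0 1) - color (p 0 0)) * (i - h)) * three

theorem reflect (hp : Patch n p) : Patch n fun h i => p h (n - h - i) where
  row h i hi := by
    have := hp.row h (n - h - (i + 1)) (by omega)
    rwa [show n - h - (i + 1) + 1 = n - h - i by omega, gd_comm] at this
  up h i hi := by
    have := hp.diag h (n - (h + 1) - i) (by omega)
    rwa [show n - (h + 1) - i + 1 = n - h - i by omega] at this
  diag h i hi := by
    have := hp.up h (n - (h + 1) - i) (by omega)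
    rwa [show n - h - (i + 1) = n - (h + 1) - i by omega]
  inj h i h' i' hi hi' e := by
    have := hp.inj _ _ _ _ (by omega) (by omega) e
    omega

end Patch

theorem Thin.symm {v w : V} (h : Thin v w) : Thin w v := fun q r s a b c d e f =>
  h q r s b a d c f e

theorem short_or_two : ∀ u : Simple, IsAtom u → u.val ∈ [1, 2, 3, 6] ∨
    ∃ s t, ∀ y, IsAtom y → rest u y = 0 → y = s ∨ y = t := by decide +kernel

/-- Edges with a long label are thin. -/
theorem mem_of_not_thin {x : B4} {u : Simple} (hu : IsAtom u)
    (h : ¬ Thin (vert x) (vert (x * val u))) : u.val ∈ [1, 2, 3, 6] := by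
  refine (short_or_two u hu).resolve_right fun ⟨s, t, hst⟩ => h ?_
  have key : ∀ q, gd (vert x) q = 1 → gd (vert (x * val u)) q = 1 →
      q = vert (x * val u * val s) ∨ q = vert (x * val u * val t) := by
    intro q h1 h2
    obtain ⟨y, rfl, hx, hxy⟩ := exists_lift h1.le
    have hn : ∀ {v w : V}, gd v w = 1 → v ≠ w := fun h e => by rw [e, gd_self] at h; omega
    have d1 := deg_lt hx fun e => hn h1 (by rw [e])
    have d2 := deg_lt hxy fun e => hn h1 (by rw [e, vert_sh])
    have d3 := color_ne h2
    have hu' : deg (x * val u) = deg x + 1 := by rw [deg_mul, deg_val, hu]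
    rw [color_vert, color_vert, hu'] at d3
    have d4 : deg y ≠ deg x + 1 := fun e => d3 (by rw [e])
    rw [deg_sh] at d2
    push_cast at d2
    obtain ⟨e1, e2⟩ := between_of_adjacent h2 (by omega) (by omega)
    obtain ⟨y', rfl⟩ := exists_mul_val e1 e2
    obtain ⟨w, hw⟩ := exists_mul_val hx hxy
    have hy' : IsAtom y' := by
      have hu'' : rank u = 1 := hu
      change rank y' = 1
      simp only [deg_mul, deg_val, hu''] at d1 d2 d4
      omega
    rw [mul_assoc] at hw
    rcases hst y' hy' (rest_eq_zero_of_mul (mul_left_cancel hw)).1 with rfl | rfl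
    · exact Or.inl rfl
    · exact Or.inr rfl
  intro q r w a1 a2 b1 b2 c1 c2
  rcases key q a1 a2 with rfl | rfl <;> rcases key r b1 b2 with rfl | rfl <;>
    rcases key w c1 c2 with rfl | rfl <;> simp

namespace Patch

variable {n : ℕ} {p : ℕ → ℕ → V}

theorem exists_thin_of_color (hp : Patch n p) (hn : 5 ≤ n)
    (hc : color (p 0 1) = color (p 0 0) + 1) (h1 : ∀ i, i + 1 ≤ n → ¬ Thin (p 0 i) (p 0 (i + 1)))
    (h2 : ∀ h, h + 1 ≤ n → ¬ Thin (p h 0) (p (h + 1) 0))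
    (h3 : ∀ h i, h + i + 1 = n → ¬ Thin (p h (i + 1)) (p (h + 1) i)) : False := by
  obtain ⟨x₀, hx₀⟩ := vert_surjective (p 0 0)
  have hlift : ∀ h i, ∃ x, h + i ≤ n → vert x = p h i ∧ deg x = deg x₀ + i + 2 * h := by
    intro h i
    by_cases hi : h + i ≤ n
    · obtain ⟨x, hx⟩ := exists_deg_eq (v := p h i) (d := deg x₀ + i + 2 * h) (by
        rw [hp.color_eq h i hi, hc, ← hx₀, color_vert]
        have three : (3 : ZMod 3) = 0 := rfl
        push_cast
        linear_combination -(h : ZMod 3) * three)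
      exact ⟨x, fun _ => hx⟩
    · exact ⟨1, fun h => absurd h hi⟩
  choose x hx using hlift
  have step : ∀ h i h' i' (k : ℤ), h + i ≤ n → h' + i' ≤ n → gd (p h i) (p h' i') = 1 →
      (i' + 2 * h' + 3 * k : ℤ) = i + 2 * h + 1 →
      ∃ u, IsAtom u ∧ sh k (x h' i') = x h i * val u := by
    intro h i h' i' k hi hi' hg hd
    obtain ⟨e1, e2⟩ := hx h i hi
    obtain ⟨e3, e4⟩ := hx h' i' hi'
    have := between_of_adjacent (x := x h i) (y := sh k (x h' i'))
      (by rwa [vert_sh, e1, e3]) (by rw [deg_sh]; omega) (by rw [deg_sh]; omega)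
    obtain ⟨u, hu⟩ := exists_mul_val this.1 this.2
    refine ⟨u, ?_, hu⟩
    have h5 := congrArg deg hu
    rw [deg_sh, deg_mul, deg_val] at h5
    change rank u = 1
    omega
  have hU : ∀ h i, ∃ u, h + i + 1 ≤ n → IsAtom u ∧ x h (i + 1) = x h i * val u := by
    intro h i
    by_cases hi : h + i + 1 ≤ n
    · obtain ⟨u, hu⟩ := step h i h (i + 1) 0 (by omega) (by omega) (hp.row h i hi)
        (by push_cast; ring)
      exact ⟨u, fun _ => by simpa using hu⟩
    · exact ⟨0, fun h => absurd h hi⟩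
  have hY : ∀ h i, ∃ u, h + i + 1 ≤ n → IsAtom u ∧ x (h + 1) i = x h (i + 1) * val u := by
    intro h i
    by_cases hi : h + i + 1 ≤ n
    · obtain ⟨u, hu⟩ := step h (i + 1) (h + 1) i 0 (by omega) (by omega) (hp.diag h i hi)
        (by push_cast; ring)
      exact ⟨u, fun _ => by simpa using hu⟩
    · exact ⟨0, fun h => absurd h hi⟩
  have hZ : ∀ h i, ∃ u, h + i + 1 ≤ n → IsAtom u ∧ sh 1 (x h i) = x (h + 1) i * val u := by
    intro h i
    by_cases hi : h + i + 1 ≤ n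
    · obtain ⟨u, hu⟩ := step (h + 1) i h i 1 (by omega) (by omega)
        (by rw [gd_comm]; exact hp.up h i hi) (by push_cast; ring)
      exact ⟨u, fun _ => hu⟩
    · exact ⟨0, fun h => absurd h hi⟩
  choose U hU using hU
  choose Y hY using hY
  choose Z hZ using hZ
  have hsh : ∀ h i, sh 1 (x h i) = x h i * δ := fun h i => by simp [sh]
  have up : ∀ h i, h + i + 1 ≤ n → val (U h i) * val (Y h i) * val (Z h i) = δ := by
    intro h i hi
    apply mul_left_cancel (a := x h i)
    rw [← hsh, (hZ h i hi).2, (hY h i hi).2, (hU h i hi).2]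
    simp only [mul_assoc]
  have dn : ∀ h i, h + i + 2 ≤ n → val (Y h i) * val (U (h + 1) i) * val (Z h (i + 1)) = δ := by
    intro h i hi
    apply mul_left_cancel (a := x h (i + 1))
    rw [← hsh, (hZ h (i + 1) (by omega)).2, (hU (h + 1) i (by omega)).2, (hY h i (by omega)).2]
    simp only [mul_assoc]
  have fold : ∀ h i h' i' (k k' : ℤ), h + i ≤ n → h' + i' ≤ n →
      sh k (x h i) = sh k' (x h' i') → h = h' ∧ i = i' := by
    intro h i h' i' k k' hi hi' e
    refine hp.inj _ _ _ _ hi hi' ?_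
    rw [← (hx h i hi).1, ← (hx h' i' hi').1, ← vert_sh k, e, vert_sh]
  have tiling : Tiling n (fun h i => (U h i).val) (fun h i => (Y h i).val)
      (fun h i => (Z h i).val) := by
    refine ⟨fun h i hi => (factor_tails (hU h i hi).1 (hY h i hi).1 (hZ h i hi).1 (up h i hi)).1,
      fun h i hi => (factor_tails (hY h i (by omega)).1 (hU (h + 1) i (by omega)).1
        (hZ h (i + 1) (by omega)).1 (dn h i hi)).2,
      fun h i hi e => ?_, fun h i hi e => ?_, fun h i hi e => ?_⟩
    · have := fold h (i + 1 + 1) (h + 1) i 0 0 (by omega) (by omega) (by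
        simp only [sh_zero]
        rw [(hU h (i + 1) (by omega)).2, (hY h i (by omega)).2, Fin.ext e])
      omega
    · have := fold (h + 1 + 1) i h (i + 1) 0 1 (by omega) (by omega) (by
        rw [(hZ h (i + 1) (by omega)).2, sh_zero, (hY (h + 1) i (by omega)).2, Fin.ext e])
      omega
    · have := fold (h + 1) (i + 1) h i 0 1 (by omega) (by omega) (by
        rw [(hZ h i (by omega)).2, sh_zero, (hU (h + 1) i (by omega)).2, Fin.ext e])
      omega
  have short : ∀ m : ℕ, m ∈ [1, 2, 3, 6] → shortAtom m = true := by decide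
  obtain ⟨h, i, hi, hs⟩ := tiling.exists_long hn (fun i hi => by
    obtain ⟨e1, e2⟩ := hU 0 i (by omega)
    refine mem_of_not_thin e1 (x := x 0 i) ?_
    rw [← e2, (hx 0 i (by omega)).1, (hx 0 (i + 1) (by omega)).1]
    exact h1 i hi) (fun h hh => by
    obtain ⟨e1, e2⟩ := hZ h 0 (by omega)
    refine short _ (mem_of_not_thin e1 (x := x (h + 1) 0) ?_)
    rw [← e2, vert_sh, (hx h 0 (by omega)).1, (hx (h + 1) 0 (by omega)).1]
    exact fun ht => h2 h hh ht.symm)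
  obtain ⟨e1, e2⟩ := hY h i (by omega)
  refine absurd (short _ (mem_of_not_thin e1 (x := x h (i + 1)) ?_)) (by simpa using hs)
  rw [← e2, (hx h (i + 1) (by omega)).1, (hx (h + 1) i (by omega)).1]
  exact h3 h i hi

/-- A patch with side at least `5` has a thin edge on its boundary. -/
theorem exists_thin (hp : Patch n p) (hn : 5 ≤ n)
    (h1 : ∀ i, i + 1 ≤ n → ¬ Thin (p 0 i) (p 0 (i + 1)))
    (h2 : ∀ h, h + 1 ≤ n → ¬ Thin (p h 0) (p (h + 1) 0))
    (h3 : ∀ h i, h + i + 1 = n → ¬ Thin (p h (i + 1)) (p (h + 1) i)) : False := by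
  by_cases hc : color (p 0 1) = color (p 0 0) + 1
  · exact hp.exists_thin_of_color hn hc h1 h2 h3
  · have e : ∀ x y : ZMod 3, x ≠ y → y ≠ x + 1 → y - x = -1 := by decide
    have e' := e _ _ (color_ne (hp.row 0 0 (by omega))) hc
    refine hp.reflect.exists_thin_of_color hn ?_ (fun i hi ht => ?_) (fun h hh ht => ?_)
      (fun h i hi ht => ?_)
    · rw [hp.color_eq 0 _ (by omega), hp.color_eq 0 (n - 0 - 0) (by omega), e']
      rw [show n - 0 - 0 = (n - 0 - 1) + 1 by omega]
      push_cast
      ring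
    · refine h1 (n - 0 - (i + 1)) (by omega) ?_
      rw [show n - 0 - (i + 1) + 1 = n - 0 - i by omega]
      exact ht.symm
    · refine h3 h (n - (h + 1) - 0) (by omega) ?_
      rw [show n - (h + 1) - 0 + 1 = n - h - 0 by omega]
      exact ht
    · refine h2 h (by omega) ?_
      rw [show n - h - (i + 1) = 0 by omega, show n - (h + 1) - i = 0 by omega] at ht
      exact ht

end Patch

/-- The vertices close to one reached from the base `β, γ`. -/
def Near (N : ℕ) (β γ : V) : Set V := {κ | ∃ m ∈ Reach N β γ, gd m κ ≤ 4}

namespace Flat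

variable {n : ℕ} {α β γ : V} {p : ℕ → ℕ → V}

theorem exists_height (n : ℕ) (p : ℕ → ℕ → V) : ∃ a, 1 ≤ a ∧ ¬ ThinRow n p a ∧
    ∀ k, 1 ≤ k → k < a → ThinRow n p k := by
  classical
  have hex : ∃ a, 1 ≤ a ∧ ¬ ThinRow n p a :=
    ⟨n + 1, by omega, fun ⟨i, hi, _⟩ => by omega⟩
  refine ⟨Nat.find hex, (Nat.find_spec hex).1, (Nat.find_spec hex).2, fun k h1 h2 => ?_⟩
  by_contra h3
  exact Nat.find_min hex h2 ⟨h1, h3⟩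

theorem patch (hp : Flat n α β γ p) {a c m : ℕ} (hm : a + c + m ≤ n) :
    Patch m fun h i => p (a + h) (c + i) where
  row h i hi := hp.row (a + h) (c + i) (by omega)
  up h i hi := hp.up (a + h) (c + i) (by omega)
  diag h i hi := hp.diag (a + h) (c + i) (by omega)
  inj h i h' i' hi hi' e := by
    have := hp.injective (by omega) (by omega) e
    omega

theorem gd_row_le (hp : Flat n α β γ p) (h i k : ℕ) (hk : h + i + k ≤ n) :
    gd (p h (i + k)) (p h i) ≤ k := by
  induction k with
  | zero => simp
  | succ k ih =>
    have h1 := ih (by omega)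
    have h2 := hp.row h (i + k) (by omega)
    have h3 := gd_triangle (p h (i + (k + 1))) (p h (i + k)) (p h i)
    rw [gd_comm] at h2
    rw [← add_assoc] at h3 ⊢
    omega

/-- A flat triangle has a vertex which is close to vertices reached from each of its sides. -/
theorem exists_near (hp : Flat n α β γ p) {N : ℕ} (hN : n ≤ N) :
    ∃ κ, κ ∈ Near N β γ ∧ κ ∈ Near N γ α ∧ κ ∈ Near N α β := by
  obtain ⟨a, ha, ha1, ha2⟩ := exists_height n p
  obtain ⟨b, hb, hb1, hb2⟩ := exists_height n fun h i => p i (n - h - i)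
  obtain ⟨c, hc, hc1, hc2⟩ := exists_height n fun h i => p (n - h - i) (n - i - (n - h - i))
  have hsum : n ≤ a + b + c + 4 := by
    by_contra hlt
    refine (hp.patch (a := a) (c := c) (m := n - a - b - c) (by omega)).exists_thin (by omega)
      (fun i hi ht => ha1 ⟨c + i, by omega, ht⟩)
      (fun h hh ht => hc1 ⟨n - c - (a + h + 1), by omega, ?_⟩)
      (fun h i hi ht => hb1 ⟨a + h, by omega, ?_⟩)
    · simp only
      rw [show n - c - (n - c - (a + h + 1)) = a + h + 1 by omega,
        show n - (n - c - (a + h + 1)) - (a + h + 1) = c by omega,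
        show n - c - (n - c - (a + h + 1) + 1) = a + h by omega,
        show n - (n - c - (a + h + 1) + 1) - (a + h) = c by omega]
      exact ht.symm
    · simp only
      rw [show n - b - (a + h) = c + (i + 1) by omega,
        show n - b - (a + h + 1) = c + i by omega]
      exact ht
  obtain ⟨h, i, j, h1, h2, h3, h4⟩ : ∃ h i j, h + i + j = n ∧ h ≤ a ∧ i ≤ c ∧ j ≤ b + 4 := by
    refine ⟨min a n, min c (n - min a n), n - min a n - min c (n - min a n), ?_, ?_, ?_, ?_⟩ <;>
      omega
  refine ⟨p h i, ⟨p h i, ⟨n, hN, α, p, h, i, hp, by omega, fun k k1 k2 => ha2 k k1 (by omega), rfl⟩,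
    by simp⟩, ?_, ⟨p h i, ⟨n, hN, γ, _, i, j, hp.rotate.rotate, by omega,
      fun k k1 k2 => hc2 k k1 (by omega), ?_⟩, by simp⟩⟩
  · refine ⟨p h (i + (j - b)), ⟨n, hN, β, _, min j b, h, hp.rotate, by omega,
      fun k k1 k2 => hb2 k k1 (by omega), ?_⟩, (hp.gd_row_le h i (j - b) (by omega)).trans (by omega)⟩
    rw [show n - min j b - h = i + (j - b) by omega]
  · rw [show n - i - j = h by omega, show n - j - h = i by omega]

end Flat

/-- Candidates for the center of a triangle two of whose corners are `u` and `v`. -/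
def Centers (R : ℕ) (u v : V) : Set V :=
  {κ | ∃ β ∈ {β | Btw u v β ∧ gd u β ≤ R}, ∃ γ ∈ {γ | Btw u v γ ∧ gd u γ ≤ R}, κ ∈ Near R β γ}

theorem small_near (N : ℕ) (β γ : V) : Small (Near N β γ) (14 * ((N + 1) * (N + 1)) * 14 ^ 4) :=
  (small_reach N β γ).bind (T := fun m => {κ | gd m κ ≤ 4}) fun m _ => small_ball m 4

theorem small_centers (R : ℕ) (u v : V) : Small (Centers R u v)
    ((R + 1) * (3 * R + 1) * ((R + 1) * (3 * R + 1) * (14 * ((R + 1) * (R + 1)) * 14 ^ 4))) := by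
  refine (small_interval u v R).bind (T := fun β => {κ | ∃ γ ∈ {γ | Btw u v γ ∧ gd u γ ≤ R},
    κ ∈ Near R β γ}) fun β _ => (small_interval u v R).bind (T := fun γ => Near R β γ)
      fun γ _ => small_near R β γ

theorem exists_center {x y : V} (z : V) {R : ℕ} (h : gd x y ≤ R) :
    ∃ κ, κ ∈ Centers R x y ∧ κ ∈ Centers R x z ∧ κ ∈ Centers R y z := by
  obtain ⟨α, β, γ, ht, e1, e2, e3⟩ := exists_metricTriangle x y z
  obtain ⟨s1, s2⟩ := ht.sides rfl
  obtain ⟨p, hp⟩ := exists_flat _ α β γ ht rfl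
  obtain ⟨κ, k1, k2, k3⟩ := hp.exists_near (N := R) (by omega)
  have t1 := gd_triangle x α β
  have t2 := gd_triangle x α γ
  have t3 := gd_triangle y β γ
  have t4 := gd_triangle α β y
  have t5 := gd_triangle α γ z
  have t6 := gd_triangle β γ z
  have t7 := gd_triangle x β y
  have t8 := gd_triangle x γ z
  have t9 := gd_triangle y γ z
  have t10 := gd_triangle x α y
  have t11 := gd_triangle x α z
  have t12 := gd_triangle y β z
  have c1 := gd_comm y β
  refine ⟨κ, ⟨α, ⟨?_, ?_⟩, β, ⟨?_, ?_⟩, k3⟩, ⟨γ, ⟨?_, ?_⟩, α, ⟨?_, ?_⟩, k2⟩,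
    ⟨β, ⟨?_, ?_⟩, γ, ⟨?_, ?_⟩, k1⟩⟩ <;> unfold Btw at * <;> omega

/-! ### Invariance -/

theorem Btw.smul (g : B4) {u v q : V} (h : Btw u v q) : Btw (g • u) (g • v) (g • q) := by
  unfold Btw at *
  simpa only [gd_smul] using h

theorem gd_smul_left (g : B4) (v w : V) : gd (g • v) w = gd v (g⁻¹ • w) := by
  rw [← gd_smul g v, smul_inv_smul]

theorem Btw.of_smul {g : B4} {u v q : V} (h : Btw (g • u) (g • v) q) : Btw u v (g⁻¹ • q) := by
  simpa using h.smul g⁻¹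

theorem MetricTriangle.smul (g : B4) {α β γ : V} (h : MetricTriangle α β γ) :
    MetricTriangle (g • α) (g • β) (g • γ) where
  fst q h1 h2 := by rw [← h.fst _ h1.of_smul h2.of_smul, smul_inv_smul]
  snd q h1 h2 := by rw [← h.snd _ h1.of_smul h2.of_smul, smul_inv_smul]
  thd q h1 h2 := by rw [← h.thd _ h1.of_smul h2.of_smul, smul_inv_smul]

theorem Flat.smul (g : B4) {n : ℕ} {α β γ : V} {p : ℕ → ℕ → V} (h : Flat n α β γ p) :
    Flat n (g • α) (g • β) (g • γ) fun h i => g • p h i where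
  tri := h.tri.smul g
  dist_fst k i := by simpa only [gd_smul] using h.dist_fst k i
  dist_snd k i := by simpa only [gd_smul] using h.dist_snd k i
  dist_thd k i := by simpa only [gd_smul] using h.dist_thd k i
  row k i := by simpa only [gd_smul] using h.row k i
  up k i := by simpa only [gd_smul] using h.up k i
  diag k i := by simpa only [gd_smul] using h.diag k i

theorem Thin.smul (g : B4) {v w : V} (h : Thin v w) : Thin (g • v) (g • w) := by
  intro q r s
  simp only [gd_smul_left]
  intro h1 h2 h3 h4 h5 h6
  simpa using h _ _ _ h1 h2 h3 h4 h5 h6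

theorem smul_mem_near (g : B4) {N : ℕ} {β γ κ : V} (h : κ ∈ Near N β γ) :
    g • κ ∈ Near N (g • β) (g • γ) := by
  obtain ⟨_, ⟨n, hn, α, p, k, i, h1, h2, h3, rfl⟩, h4⟩ := h
  refine ⟨g • p k i, ⟨n, hn, g • α, _, k, i, h1.smul g, h2, fun l l1 l2 => ?_, rfl⟩, ?_⟩
  · obtain ⟨i, hi, ht⟩ := h3 l l1 l2
    exact ⟨i, hi, ht.smul g⟩
  · rwa [gd_smul]

theorem smul_mem_centers (g : B4) {R : ℕ} {u v κ : V} (h : κ ∈ Centers R u v) :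
    g • κ ∈ Centers R (g • u) (g • v) := by
  obtain ⟨β, ⟨h1, h2⟩, γ, ⟨h3, h4⟩, h5⟩ := h
  exact ⟨g • β, ⟨h1.smul g, by rwa [gd_smul]⟩, g • γ, ⟨h3.smul g, by rwa [gd_smul]⟩,
    smul_mem_near g h5⟩

/-! ### Centers in the group -/

theorem small_vert_eq (v : V) (K : ℕ) : Small {g : B4 | vert g = v ∧ |deg g| ≤ K} (2 * K + 1) := by
  refine small_of_rel (Finset.Icc (-(K : ℤ)) K) (by simp; omega) (fun d g => deg g = d) ?_ ?_
  · rintro g ⟨-, hg⟩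
    exact ⟨deg g, by simpa [abs_le] using hg, rfl⟩
  · rintro d g ⟨rfl, -⟩ g' ⟨h1, -⟩ e e'
    obtain ⟨k, rfl⟩ := vert_eq_iff.1 h1
    rw [deg_sh] at e
    obtain rfl : k = 0 := by omega
    simp

def groupCenters (R K : ℕ) (t : B4) : Set B4 :=
  {g | vert g ∈ Centers R (vert 1) (vert t) ∧ |deg g| ≤ K}

theorem small_groupCenters (R K : ℕ) (t : B4) : Small (groupCenters R K t)
    ((R + 1) * (3 * R + 1) * ((R + 1) * (3 * R + 1) * (14 * ((R + 1) * (R + 1)) * 14 ^ 4)) *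
      (2 * K + 1)) := by
  refine ((small_centers R (vert 1) (vert t)).bind
    (T := fun v => {g : B4 | vert g = v ∧ |deg g| ≤ K}) fun v _ => small_vert_eq v K).mono ?_ le_rfl
  exact fun g hg => ⟨vert g, hg.1, rfl, hg.2⟩

theorem exists_groupCenter {R K : ℕ} {y : B4} (z : B4) (h : gd (vert 1) (vert y) ≤ R)
    (hK : |deg y| + 3 ≤ K) : ∃ κ, κ ∈ groupCenters R K y ∧ κ ∈ groupCenters R K z ∧
      y⁻¹ * κ ∈ groupCenters R K (y⁻¹ * z) := by
  obtain ⟨v, h1, h2, h3⟩ := exists_center (vert z) h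
  obtain ⟨x, rfl⟩ := vert_surjective v
  have h4 := smul_mem_centers y⁻¹ h3
  rw [smul_vert, smul_vert, smul_vert, inv_mul_cancel] at h4
  have e : vert (sh (-(deg x / 3)) x) = vert x := vert_sh _ _
  rw [abs_eq_max_neg] at hK
  have hd := deg_sh (-(deg x / 3)) x
  refine ⟨sh (-(deg x / 3)) x, ⟨by rwa [e], ?_⟩, ⟨by rwa [e], ?_⟩, ⟨?_, ?_⟩⟩
  · rw [abs_le]; omega
  · rw [abs_le]; omega
  · rwa [mul_sh, vert_sh]
  · rw [deg_mul, deg_inv, abs_le]; omega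

/-! ### Property RD from small systems of centers -/

section Criterion

open Finset

theorem sum_sum_filter_le {α β : Type*} {s : Finset α} {t : Finset β} {r : α → β → Prop}
    [∀ x y, Decidable (r x y)] {P : ℕ} (w : β → ℝ) (hw : ∀ y, 0 ≤ w y)
    (hP : ∀ y ∈ t, #{x ∈ s | r x y} ≤ P) :
    ∑ x ∈ s, ∑ y ∈ t with r x y, w y ≤ P * ∑ y ∈ t, w y := by
  simp_rw [sum_filter]
  rw [sum_comm, mul_sum]
  refine sum_le_sum fun y hy => ?_
  rw [← sum_filter, sum_const, nsmul_eq_mul]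
  exact mul_le_mul_of_nonneg_right (by exact_mod_cast hP y hy) (hw y)

variable {Γ : Type*} [Group Γ] [DecidableEq Γ]

theorem sum_translate_le {S : Γ → Finset Γ} {P : ℕ} (hS : ∀ t, #(S t) ≤ P) {G : Γ → ℝ}
    (A B D : Finset Γ) (hB : ∀ t ∉ B, G t = 0) (κ : Γ) :
    ∑ z ∈ D, ∑ y ∈ A with y⁻¹ * κ ∈ S (y⁻¹ * z), G (y⁻¹ * z) ^ 2 ≤ P * ∑ t ∈ B, G t ^ 2 := by
  have key : ∑ y ∈ A, ∑ t ∈ B with y⁻¹ * κ ∈ S t, G t ^ 2 ≤ P * ∑ t ∈ B, G t ^ 2 := by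
    refine sum_sum_filter_le (fun t => G t ^ 2) (fun t => sq_nonneg _) fun t _ => ?_
    refine (card_le_card_of_injOn (fun y => y⁻¹ * κ) ?_ ?_).trans (hS t)
    · intro y hy
      exact (mem_filter.1 hy).2
    · intro y _ y' _ h
      simpa using h
  refine le_trans ?_ key
  simp_rw [sum_filter]
  rw [sum_comm]
  refine sum_le_sum fun y _ => ?_
  have e : ∑ z ∈ D, (if y⁻¹ * κ ∈ S (y⁻¹ * z) then G (y⁻¹ * z) ^ 2 else 0) =
      ∑ t ∈ D.image (y⁻¹ * ·), if y⁻¹ * κ ∈ S t then G t ^ 2 else 0 := by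
    rw [sum_image]
    intro z _ z' _ h
    simpa using h
  rw [e, ← sum_filter_ne_zero]
  refine sum_le_sum_of_subset_of_nonneg (fun t ht => ?_) fun _ _ _ => by positivity
  by_contra h
  simp [hB t h] at ht

theorem sum_sq_convolution_le {S : Γ → Finset Γ} {P : ℕ} (hS : ∀ t, #(S t) ≤ P) {F G : Γ → ℝ}
    (A B D : Finset Γ) (hB : ∀ t ∉ B, G t = 0)
    (h : ∀ y ∈ A, ∀ z, ∃ κ, κ ∈ S y ∧ κ ∈ S z ∧ y⁻¹ * κ ∈ S (y⁻¹ * z)) :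
    ∑ z ∈ D, (∑ y ∈ A, F y * G (y⁻¹ * z)) ^ 2 ≤
      (P : ℝ) ^ 3 * (∑ y ∈ A, F y ^ 2) * ∑ t ∈ B, G t ^ 2 := by
  choose! k h1 h2 h3 using h
  set E := D.biUnion S
  set U : Γ → ℝ := fun κ => ∑ y ∈ A with κ ∈ S y, F y ^ 2
  set W : Γ → Γ → ℝ := fun κ z => ∑ y ∈ A with y⁻¹ * κ ∈ S (y⁻¹ * z), G (y⁻¹ * z) ^ 2
  have hU : ∀ κ, 0 ≤ U κ := fun κ => sum_nonneg fun _ _ => sq_nonneg _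
  have hW : ∀ κ z, 0 ≤ W κ z := fun κ z => sum_nonneg fun _ _ => sq_nonneg _
  have hz : ∀ z ∈ D, (∑ y ∈ A, F y * G (y⁻¹ * z)) ^ 2 ≤ P * ∑ κ ∈ E, U κ * W κ z := by
    intro z hz
    rw [← sum_fiberwise_of_maps_to (g := fun y => k y z) (t := S z) fun y hy => h2 y hy z]
    refine sq_sum_le_card_mul_sum_sq.trans ?_
    refine mul_le_mul (by exact_mod_cast hS z) ?_ (sum_nonneg fun _ _ => sq_nonneg _)
      (by positivity)
    refine le_trans (sum_le_sum fun κ _ => ?_) (sum_le_sum_of_subset_of_nonneg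
      (subset_biUnion_of_mem S hz) fun κ _ _ => mul_nonneg (hU κ) (hW κ z))
    refine (sum_mul_sq_le_sq_mul_sq _ _ _).trans (mul_le_mul ?_ ?_
      (sum_nonneg fun _ _ => sq_nonneg _) (hU κ))
    · refine sum_le_sum_of_subset_of_nonneg ?_ fun _ _ _ => sq_nonneg _
      intro y hy
      obtain ⟨hyA, e⟩ := mem_filter.1 hy
      subst e
      exact mem_filter.2 ⟨hyA, h1 y hyA z⟩
    · refine sum_le_sum_of_subset_of_nonneg ?_ fun _ _ _ => sq_nonneg _
      intro y hy
      obtain ⟨hyA, e⟩ := mem_filter.1 hy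
      subst e
      exact mem_filter.2 ⟨hyA, h3 y hyA z⟩
  have hsum : ∑ κ ∈ E, U κ ≤ P * ∑ y ∈ A, F y ^ 2 := by
    refine sum_sum_filter_le (fun y => F y ^ 2) (fun y => sq_nonneg _) fun y _ => ?_
    exact (card_le_card fun κ hκ => (mem_filter.1 hκ).2).trans (hS y)
  have hG : (0 : ℝ) ≤ ∑ t ∈ B, G t ^ 2 := sum_nonneg fun _ _ => sq_nonneg _
  calc _ ≤ ∑ z ∈ D, P * ∑ κ ∈ E, U κ * W κ z := sum_le_sum hz
    _ = P * ∑ κ ∈ E, U κ * ∑ z ∈ D, W κ z := by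
      rw [← mul_sum, sum_comm]
      simp_rw [mul_sum]
    _ ≤ P * ∑ κ ∈ E, U κ * (P * ∑ t ∈ B, G t ^ 2) := by
      gcongr with κ _
      exact sum_translate_le hS A B D hB κ
    _ = P * (∑ κ ∈ E, U κ) * (P * ∑ t ∈ B, G t ^ 2) := by rw [← sum_mul, mul_assoc]
    _ ≤ P * (P * ∑ y ∈ A, F y ^ 2) * (P * ∑ t ∈ B, G t ^ 2) := by gcongr
    _ = _ := by ring

theorem conv_apply (f g : Γ →₀ ℂ) (z : Γ) :
    conv f g z = ∑ y ∈ f.support, f y * g (y⁻¹ * z) := by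
  rw [conv, Finsupp.sum, Finsupp.finsetSum_apply]
  refine sum_congr rfl fun y _ => ?_
  rw [Finsupp.sum, Finsupp.finsetSum_apply]
  simp only [Finsupp.single_apply, ← eq_inv_mul_iff_mul_eq]
  rw [sum_ite_eq' g.support (y⁻¹ * z) fun x => f y * g x]
  split_ifs with h
  · rfl
  · simp [Finsupp.notMem_support_iff.1 h]

theorem l2norm_nonneg {Γ : Type*} (f : Γ →₀ ℂ) : 0 ≤ l2norm f := Real.sqrt_nonneg _

theorem l2norm_sq {Γ : Type*} (f : Γ →₀ ℂ) : l2norm f ^ 2 = ∑ x ∈ f.support, ‖f x‖ ^ 2 :=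
  Real.sq_sqrt (sum_nonneg fun _ _ => sq_nonneg _)

theorem l2norm_conv_le {S : Γ → Finset Γ} {P : ℕ} (hS : ∀ t, #(S t) ≤ P) (f g : Γ →₀ ℂ)
    (h : ∀ y, f y ≠ 0 → ∀ z, ∃ κ, κ ∈ S y ∧ κ ∈ S z ∧ y⁻¹ * κ ∈ S (y⁻¹ * z)) :
    l2norm (conv f g) ≤ (P : ℝ) ^ 2 * l2norm f * l2norm g := by
  have key := sum_sq_convolution_le hS (F := fun y => ‖f y‖) (G := fun y => ‖g y‖) f.support
    g.support (conv f g).support (fun t ht => by simpa using ht)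
    fun y hy => h y (Finsupp.mem_support_iff.1 hy)
  refine le_of_sq_le_sq ?_ (by have := l2norm_nonneg f; have := l2norm_nonneg g; positivity)
  rw [mul_pow, mul_pow, ← pow_mul, l2norm_sq, l2norm_sq, l2norm_sq]
  have hP : (P : ℝ) ^ 3 ≤ (P : ℝ) ^ (2 * 2) := by
    exact_mod_cast P.eq_zero_or_pos.elim (fun h => by simp [h])
      fun h => Nat.pow_le_pow_right h (by norm_num)
  calc _ ≤ ∑ z ∈ (conv f g).support, (∑ y ∈ f.support, ‖f y‖ * ‖g (y⁻¹ * z)‖) ^ 2 := by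
        gcongr with z _
        rw [conv_apply]
        refine (norm_sum_le _ _).trans_eq ?_
        simp
    _ ≤ _ := key
    _ ≤ _ := by gcongr

end Criterion

/-! ### The word length -/

theorem exists_word_of_wordLength (x : B4) : ∃ w : List B4,
    w.length = wordLength ({a, b, c} : Set B4) x ∧
      (∀ s ∈ w, s ∈ ({a, b, c} : Set B4) ∨ s⁻¹ ∈ ({a, b, c} : Set B4)) ∧ w.prod = x := by
  obtain ⟨w, hw, e⟩ := exists_word x
  exact Nat.sInf_mem (s := {n : ℕ | ∃ w : List B4, w.length = n ∧
    (∀ s ∈ w, s ∈ ({a, b, c} : Set B4) ∨ s⁻¹ ∈ ({a, b, c} : Set B4)) ∧ w.prod = x})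
    ⟨_, w, rfl, hw, e⟩

theorem abs_deg_prod_le (w : List B4)
    (hw : ∀ s ∈ w, s ∈ ({a, b, c} : Set B4) ∨ s⁻¹ ∈ ({a, b, c} : Set B4)) :
    |deg w.prod| ≤ w.length := by
  induction w with
  | nil => simp
  | cons s w ih =>
    have h1 := ih fun t ht => hw t (List.mem_cons_of_mem _ ht)
    have h2 : deg s = 1 ∨ -deg s = 1 := by
      rw [← deg_inv]
      refine (hw s List.mem_cons_self).imp ?_ ?_ <;> rintro (h | h | h) <;> rw [h] <;> simp
    rw [List.prod_cons, deg_mul, List.length_cons, abs_le]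
    rw [abs_le] at h1
    push_cast
    omega

theorem abs_deg_le (x : B4) : |deg x| ≤ wordLength ({a, b, c} : Set B4) x := by
  obtain ⟨w, h, hw, rfl⟩ := exists_word_of_wordLength x
  exact h ▸ abs_deg_prod_le w hw

theorem gd_one_le (x : B4) :
    gd (vert 1) (vert x) ≤ 2 * wordLength ({a, b, c} : Set B4) x := by
  obtain ⟨w, h, hw, rfl⟩ := exists_word_of_wordLength x
  obtain ⟨h1, h2⟩ := word_between w hw
  rw [← h, ← vert_sh (-(w.length : ℤ)) 1]
  refine gd_le (by simpa [sh] using h1) ?_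
  rw [sh_sh]
  convert h2 using 1
  rw [sh, one_mul, ← zpow_natCast]
  congr 1
  push_cast
  ring

/-- A polynomial dominating the cardinality of `groupCenters (2 * n) (n + 3) t`. -/
noncomputable def centerPoly : Polynomial ℝ :=
  let X : Polynomial ℝ := Polynomial.X
  (2 * X + 1) * (6 * X + 1) *
    ((2 * X + 1) * (6 * X + 1) * (14 * ((2 * X + 1) * (2 * X + 1)) * 14 ^ 4)) * (2 * X + 7)

end BraidFour

open BraidFour in
/-- The braid group `B₄` has property RD with respect to the word length
associated to the generating set `{a, b, c}`. -/
theorem B4_hasPropertyRD :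
    HasPropertyRD B4 (fun x => (wordLength ({a, b, c} : Set B4) x : ℝ)) := by
  classical
  refine ⟨centerPoly ^ 2, fun r hr f g hf => ?_⟩
  choose S hS hsub using small_groupCenters (2 * ⌊r⌋₊) (⌊r⌋₊ + 3)
  simp_rw [Set.subset_def] at hsub
  refine (l2norm_conv_le hS f g fun y hy z => ?_).trans ?_
  · have h : wordLength ({a, b, c} : Set B4) y ≤ ⌊r⌋₊ := Nat.le_floor (hf y hy)
    have h1 := abs_deg_le y
    have h2 := gd_one_le y
    obtain ⟨κ, k1, k2, k3⟩ := exists_groupCenter (R := 2 * ⌊r⌋₊) (K := ⌊r⌋₊ + 3) (y := y) z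
      (by omega) (by push_cast; omega)
    exact ⟨κ, hsub _ _ k1, hsub _ _ k2, hsub _ _ k3⟩
  · have hn := Nat.floor_le hr
    generalize (⌊r⌋₊) = n at hn
    have h1 := l2norm_nonneg f
    have h2 := l2norm_nonneg g
    rw [Polynomial.eval_pow]
    gcongr
    simp only [centerPoly, Polynomial.eval_mul, Polynomial.eval_add, Polynomial.eval_pow,
      Polynomial.eval_X, Polynomial.eval_one, Polynomial.eval_ofNat, Nat.cast_mul, Nat.cast_add,
      Nat.cast_pow, Nat.cast_ofNat, Nat.cast_one]
    have e1 : (2 * n + 1 : ℝ) ≤ 2 * r + 1 := by linarith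
    have e2 : (3 * (2 * n) + 1 : ℝ) ≤ 6 * r + 1 := by linarith
    have e3 : (2 * (n + 3) + 1 : ℝ) ≤ 2 * r + 7 := by linarith
    gcongr
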